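/- arXiv:2201.06503 — 3 statements merged into one kernel-verified Lean document; each statement's English description precedes it below -/
import Mathlib

section
/- Let q(x_{0:N}) be a joint probability density on (ℝ^d)^{N+1} with finite second moments, and let p(x_{0:N}) = p(x_N) ∏_{n=1}^N p(x_{n−1} | xₙ) be a Gaussian Markov chain with fixed p(x_N) and p(x_{n−1} | xₙ) = N(μₙ(xₙ), σₙ² I). Then the joint minimization min over {μₙ, σₙ²}_{n=1}^N of D_KL(q(x_{0:N}) ‖ p(x_{0:N})) is attained at μₙ*(xₙ) = E_{q(x_{n−1}|xₙ)}[x_{n−1}] and σₙ*² = E_{qₙ(xₙ)}[tr(Cov_{q(x_{n−1}|xₙ)}[x_{n−1}])/d] (matching the first two moments of q(x_{n−1}|xₙ)), and the optimal value satisfies D_KL(q(x_{0:N}) ‖ p*(x_{0:N})) = H(q(x_N), p(x_N)) + (d/2) ∑_{n=1}^N log(2πe σₙ*²) − H(q(x_{0:N})), where H(q, p) is the cross-entropy and H(q) the differential entropy. -/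
open MeasureTheory Finset

/-- Marginal density of the coordinates in `s` of a joint density `Q` on `(ℝ^d)^{N+1}`. -/
noncomputable def marg {N d : ℕ} (Q : (Fin (N + 1) → Fin d → ℝ) → ℝ)
    (s : Finset (Fin (N + 1))) (x : Fin (N + 1) → Fin d → ℝ) : ℝ :=
  ∫ y : {i : Fin (N + 1) // i ∉ s} → (Fin d → ℝ),
    Q (fun i => if h : i ∈ s then x i else y ⟨i, h⟩)

/-- Isotropic Gaussian density `N(μ, s·I)` on `ℝ^d`. -/
noncomputable def gaussIso (d : ℕ) (μ : Fin d → ℝ) (s : ℝ) (x : Fin d → ℝ) : ℝ :=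
  (2 * Real.pi * s) ^ (-(d : ℝ) / 2) * Real.exp (-(∑ i, (x i - μ i) ^ 2) / (2 * s))

/-- Density of the Gaussian Markov (reverse) chain
`p(x_{0:N}) = p(x_N) ∏ₙ N(x_{n−1} | μₙ(xₙ), σₙ² I)`. -/
noncomputable def revJoint (d N : ℕ) (pN : (Fin d → ℝ) → ℝ)
    (μ : Fin N → (Fin d → ℝ) → (Fin d → ℝ)) (σ2 : Fin N → ℝ)
    (x : Fin (N + 1) → Fin d → ℝ) : ℝ :=
  pN (x (Fin.last N)) * ∏ n : Fin N, gaussIso d (μ n (x n.succ)) (σ2 n) (x n.castSucc)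

/-- Joint density of `(x_{n−1}, xₙ)` under `Q`, as a function of the two points. -/
noncomputable def pairD {N d : ℕ} (Q : (Fin (N + 1) → Fin d → ℝ) → ℝ) (n : Fin N)
    (u v : Fin d → ℝ) : ℝ :=
  marg Q {n.castSucc, n.succ} (fun i => if i = n.castSucc then u else v)

/-- Marginal density of `xₙ` under `Q`. -/
noncomputable def singleD {N d : ℕ} (Q : (Fin (N + 1) → Fin d → ℝ) → ℝ) (n : Fin N)
    (v : Fin d → ℝ) : ℝ :=
  marg Q {n.succ} (fun _ => v)

/-- Conditional mean `E_{q(x_{n−1}|xₙ)}[x_{n−1}]` as a function of `xₙ`. -/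
noncomputable def muStar {N d : ℕ} (Q : (Fin (N + 1) → Fin d → ℝ) → ℝ) (n : Fin N)
    (v : Fin d → ℝ) : Fin d → ℝ :=
  fun i => (∫ u, pairD Q n u v * u i) / singleD Q n v

/-- `σₙ*² = E_{qₙ(xₙ)}[tr(Cov_{q(x_{n−1}|xₙ)}[x_{n−1}])/d]`, written as the expected squared
distance of `x_{n−1}` from the conditional mean, divided by `d`. -/
noncomputable def sigmaStar2 {N d : ℕ} (Q : (Fin (N + 1) → Fin d → ℝ) → ℝ) (n : Fin N) : ℝ :=
  (∫ x, Q x * ∑ i, (x n.castSucc i - muStar Q n (x n.succ) i) ^ 2) / d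


lemma aux_var {α ι : Type*} [MeasurableSpace α] [Fintype ι] (ν : Measure α) (q : α → ℝ)
    (f : α → ι → ℝ) (hq : Integrable q ν)
    (hf : ∀ i, Integrable (fun a => q a * f a i) ν)
    (hff : ∀ i, Integrable (fun a => q a * f a i ^ 2) ν)
    (hpos : 0 < ∫ a, q a ∂ν) (c : ι → ℝ) :
    ∫ a, q a * ∑ i, (f a i - (∫ a, q a * f a i ∂ν) / ∫ a, q a ∂ν) ^ 2 ∂ν
      ≤ ∫ a, q a * ∑ i, (f a i - c i) ^ 2 ∂ν := by
  have key : ∀ c : ι → ℝ, ∫ a, q a * ∑ i, (f a i - c i) ^ 2 ∂ν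
      = ∑ i, ((∫ a, q a * f a i ^ 2 ∂ν) - 2 * c i * (∫ a, q a * f a i ∂ν)
        + c i ^ 2 * ∫ a, q a ∂ν) := by
    intro c
    have : ∀ a, q a * ∑ i, (f a i - c i) ^ 2
        = ∑ i, (q a * f a i ^ 2 - 2 * c i * (q a * f a i) + c i ^ 2 * q a) := by
      intro a
      rw [Finset.mul_sum]
      exact Finset.sum_congr rfl fun i _ => by ring
    simp_rw [this]
    rw [integral_finsetSum]
    · refine Finset.sum_congr rfl fun i _ => ?_
      have hs : Integrable (fun a => q a * f a i ^ 2 - 2 * c i * (q a * f a i)) ν :=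
        (hff i).sub ((hf i).const_mul _)
      rw [integral_add hs (hq.const_mul _),
        integral_sub (hff i) ((hf i).const_mul _), integral_const_mul, integral_const_mul]
    · intro i _
      exact ((hff i).sub ((hf i).const_mul _)).add (hq.const_mul _)
  rw [key, key]
  refine Finset.sum_le_sum fun i _ => ?_
  set S := ∫ a, q a ∂ν
  set T := ∫ a, q a * f a i ∂ν
  have hT : T = T / S * S := by field_simp
  set m := T / S
  rw [hT]
  nlinarith [mul_nonneg hpos.le (sq_nonneg (c i - m))]

/-- reindexing used to split off one coordinate -/
noncomputable def auxE {N : ℕ} (a b : Fin (N + 1)) (hab : a ≠ b) :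
    Unit ⊕ {i : Fin (N + 1) // i ∉ ({a, b} : Finset _)} ≃
      {i : Fin (N + 1) // i ∉ ({b} : Finset _)} where
  toFun := Sum.elim (fun _ => ⟨a, by simpa using hab⟩) (fun i => ⟨i.1, by
    have := i.2; simp at this ⊢; exact this.2⟩)
  invFun j := if h : j.1 = a then Sum.inl () else Sum.inr ⟨j.1, by
    have := j.2; simp at this ⊢; exact ⟨h, this⟩⟩
  left_inv := by
    rintro (x | ⟨i, hi⟩)
    · simp
    · have : i ≠ a := by simp at hi; exact hi.1
      simp [this]
  right_inv := by
    rintro ⟨j, hj⟩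
    by_cases h : j = a <;> simp [h]

lemma aux_split {N d : ℕ} (a b : Fin (N + 1)) (hab : a ≠ b)
    (G : ({i : Fin (N + 1) // i ∉ ({b} : Finset _)} → Fin d → ℝ) → ℝ) (hG : Integrable G) :
    ∫ y, G y = ∫ u : Fin d → ℝ, ∫ z : {i : Fin (N + 1) // i ∉ ({a, b} : Finset _)} → Fin d → ℝ,
      G (fun j => if h : j.1 = a then u else z ⟨j.1, by
        have := j.2; simp at this ⊢; exact ⟨h, this⟩⟩) := by
  let e1 : ((Fin d → ℝ) × ({i : Fin (N + 1) // i ∉ ({a, b} : Finset _)} → Fin d → ℝ)) ≃ᵐ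
      ((Unit → Fin d → ℝ) × ({i : Fin (N + 1) // i ∉ ({a, b} : Finset _)} → Fin d → ℝ)) :=
    MeasurableEquiv.prodCongr (MeasurableEquiv.funUnique Unit (Fin d → ℝ)).symm
      (MeasurableEquiv.refl _)
  have h1 : MeasurePreserving e1 := 
    (volume_preserving_funUnique Unit (Fin d → ℝ)).symm.prod (MeasurePreserving.id _)
  let e2 := (MeasurableEquiv.sumPiEquivProdPi
    (fun _ : Unit ⊕ {i : Fin (N + 1) // i ∉ ({a, b} : Finset _)} => Fin d → ℝ)).symm
  have h2 : MeasurePreserving e2 := volume_measurePreserving_sumPiEquivProdPi_symm _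
  let e3 := MeasurableEquiv.arrowCongr' (auxE a b hab) (MeasurableEquiv.refl (Fin d → ℝ))
  have h3 : MeasurePreserving e3 := volume_preserving_arrowCongr' _ _ (MeasurePreserving.id _)
  let e := (e1.trans e2).trans e3
  have he : MeasurePreserving e := (h3.comp h2).comp h1
  have hev : ∀ p, e p = (fun j => if h : j.1 = a then p.1 else p.2 ⟨j.1, by
        have := j.2; simp at this ⊢; exact ⟨h, this⟩⟩) := by
    rintro ⟨u, z⟩
    funext j
    change (e2 (e1 (u, z))) ((auxE a b hab).symm j) = _
    by_cases h : j.1 = a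
    · simp [auxE, h]; rfl
    · simp [auxE, h]; rfl
  rw [← he.integral_comp e.measurableEmbedding G]
  have hi : Integrable (fun p => G (e p)) :=
    (he.integrable_comp_emb e.measurableEmbedding).2 hG
  have := integral_prod _ hi
  rw [Measure.volume_eq_prod, this]
  simp_rw [hev]

lemma aux_proj {N d : ℕ} (Q : (Fin (N + 1) → Fin d → ℝ) → ℝ)
    (hQ_nonneg : ∀ x, 0 ≤ Q x) (hQ_meas : Measurable Q) (hQ : Integrable Q)
    (hmom2 : ∀ j : Fin (N + 1), Integrable (fun x => Q x * ∑ i, (x j i) ^ 2))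
    (hpos : ∀ (s : Finset (Fin (N + 1))) (x : Fin (N + 1) → Fin d → ℝ), 0 < marg Q s x)
    (n : Fin N)
    (hstar : Integrable (fun x => Q x * ∑ i, (x n.castSucc i - muStar Q n (x n.succ) i) ^ 2))
    (μ : (Fin d → ℝ) → (Fin d → ℝ))
    (hμ : Integrable (fun x => Q x * ∑ i, (x n.castSucc i - μ (x n.succ) i) ^ 2)) :
    ∫ x, Q x * ∑ i, (x n.castSucc i - muStar Q n (x n.succ) i) ^ 2
      ≤ ∫ x, Q x * ∑ i, (x n.castSucc i - μ (x n.succ) i) ^ 2 := by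
  have hab : n.castSucc ≠ n.succ := (Fin.castSucc_lt_succ).ne
  have hx2 : ∀ i, Integrable (fun x => Q x * (x n.castSucc i) ^ 2) := by
    intro i
    refine (hmom2 n.castSucc).mono' (by fun_prop) (Filter.Eventually.of_forall fun x => ?_)
    rw [Real.norm_of_nonneg (mul_nonneg (hQ_nonneg x) (sq_nonneg _))]
    exact mul_le_mul_of_nonneg_left (Finset.single_le_sum (f := fun i => x n.castSucc i ^ 2)
      (fun i _ => sq_nonneg _) (Finset.mem_univ i)) (hQ_nonneg x)
  have hx1 : ∀ i, Integrable (fun x => Q x * (x n.castSucc i)) := by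
    intro i
    refine (hQ.add (hx2 i)).mono' (by fun_prop) (Filter.Eventually.of_forall fun x => ?_)
    rw [norm_mul, Real.norm_of_nonneg (hQ_nonneg x), Real.norm_eq_abs]
    have : |x n.castSucc i| ≤ 1 + x n.castSucc i ^ 2 := by
      rw [← sq_abs]; nlinarith [sq_nonneg (|x n.castSucc i| - 1), abs_nonneg (x n.castSucc i)]
    have := mul_le_mul_of_nonneg_left this (hQ_nonneg x)
    simp only [Pi.add_apply]
    linarith
  let e := (MeasurableEquiv.piEquivPiSubtypeProd (fun _ : Fin (N + 1) => Fin d → ℝ)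
    (fun i => i ∈ ({n.succ} : Finset (Fin (N + 1))))).symm
  have he : MeasurePreserving e := by
    convert (volume_preserving_piEquivPiSubtypeProd
      (fun _ : Fin (N + 1) => Fin d → ℝ) (fun i => i ∈ ({n.succ} : Finset (Fin (N + 1))))).symm
  have hev : ∀ w y, e (w, y) = fun i => if h : i ∈ ({n.succ} : Finset (Fin (N + 1)))
      then w ⟨i, h⟩ else y ⟨i, h⟩ := fun w y => rfl
  have tr : ∀ {f : (Fin (N + 1) → Fin d → ℝ) → ℝ}, Integrable f →
      Integrable (fun p => f (e p)) (volume.prod volume) := fun hf =>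
    (he.integrable_comp_emb e.measurableEmbedding).2 hf
  rw [← he.integral_comp e.measurableEmbedding, ← he.integral_comp e.measurableEmbedding,
    Measure.volume_eq_prod, integral_prod _ (tr hstar), integral_prod _ (tr hμ)]
  refine integral_mono_ae (tr hstar).integral_prod_left (tr hμ).integral_prod_left ?_
  have s0 := (tr hQ).prod_right_ae
  have s1 := ae_all_iff.2 fun i => (tr (hx1 i)).prod_right_ae
  have s2 := ae_all_iff.2 fun i => (tr (hx2 i)).prod_right_ae
  filter_upwards [s0, s1, s2] with w s0 s1 s2
  set v : Fin d → ℝ := w ⟨n.succ, by simp⟩ with hv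
  have hsucc : ∀ y, e (w, y) n.succ = v := by
    intro y; rw [hev]; simp [hv]
  have hsing : singleD Q n v = ∫ y, Q (e (w, y)) := by
    unfold singleD marg
    congr 1
    funext y
    congr 1
    rw [hev]
    funext i
    by_cases h : i = n.succ
    · subst h; simp [hv]
    · simp [h]
  have hmu : ∀ i, muStar Q n v i
      = (∫ y, Q (e (w, y)) * e (w, y) n.castSucc i) / ∫ y, Q (e (w, y)) := by
    intro i
    unfold muStar
    rw [hsing]
    congr 1
    rw [aux_split n.castSucc n.succ hab _ (s1 i)]
    congr 1
    funext u
    unfold pairD marg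
    rw [← integral_mul_const]
    congr 1
    funext z
    congr 1
    · congr 1
      rw [hev]
      funext j
      by_cases h : j = n.succ
      · subst h; simp [hv, hab.symm]
      · by_cases h' : j = n.castSucc
        · subst h'; simp [hab]
        · simp [h, h']
    · rw [hev]
      simp [hab]
  simp_rw [hsucc, hmu]
  refine aux_var _ _ (fun y => e (w, y) n.castSucc) s0 s1 s2 ?_ _
  rw [← hsing]
  exact hpos _ _

lemma aux_log {N d : ℕ} (q : ℝ) (hq : 0 < q) (pN : (Fin d → ℝ) → ℝ) (hpN_pos : ∀ v, 0 < pN v)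
    (μ : Fin N → (Fin d → ℝ) → (Fin d → ℝ)) (σ2 : Fin N → ℝ) (hσ : ∀ n, 0 < σ2 n)
    (x : Fin (N + 1) → Fin d → ℝ) :
    q * Real.log (q / revJoint d N pN μ σ2 x)
      = q * Real.log q - q * Real.log (pN (x (Fin.last N)))
        + q * (∑ n, (d / 2 : ℝ) * Real.log (2 * Real.pi * σ2 n))
        + ∑ n, 1 / (2 * σ2 n) * (q * ∑ i, (x n.castSucc i - μ n (x n.succ) i) ^ 2) := by
  have hb : ∀ n, 0 < 2 * Real.pi * σ2 n := fun n => by have := hσ n; positivity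
  have hg : ∀ n, 0 < gaussIso d (μ n (x n.succ)) (σ2 n) (x n.castSucc) := fun n =>
    mul_pos (Real.rpow_pos_of_pos (hb n) _) (Real.exp_pos _)
  have hp := Finset.prod_pos fun n (_ : n ∈ univ) => hg n
  unfold revJoint
  rw [Real.log_div hq.ne' (mul_pos (hpN_pos _) hp).ne', Real.log_mul (hpN_pos _).ne' hp.ne',
    Real.log_prod fun n _ => (hg n).ne']
  have : ∀ n, Real.log (gaussIso d (μ n (x n.succ)) (σ2 n) (x n.castSucc))
      = -((d / 2 : ℝ) * Real.log (2 * Real.pi * σ2 n)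
        + 1 / (2 * σ2 n) * ∑ i, (x n.castSucc i - μ n (x n.succ) i) ^ 2) := by
    intro n
    unfold gaussIso
    rw [Real.log_mul (Real.rpow_pos_of_pos (hb n) _).ne' (Real.exp_pos _).ne', Real.log_exp,
      Real.log_rpow (hb n)]
    ring
  simp_rw [this]
  rw [Finset.sum_neg_distrib, Finset.sum_add_distrib]
  have : ∑ n, 1 / (2 * σ2 n) * (q * ∑ i, (x n.castSucc i - μ n (x n.succ) i) ^ 2)
      = q * ∑ n, 1 / (2 * σ2 n) * ∑ i, (x n.castSucc i - μ n (x n.succ) i) ^ 2 := by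
    rw [Finset.mul_sum]
    exact Finset.sum_congr rfl fun n _ => by ring
  rw [this]
  ring

lemma aux_val {N d : ℕ} (Q : (Fin (N + 1) → Fin d → ℝ) → ℝ)
    (hQ_pos : ∀ x, 0 < Q x) (hQ_one : ∫ x, Q x = 1) (hQ : Integrable Q)
    (pN : (Fin d → ℝ) → ℝ) (hpN_pos : ∀ v, 0 < pN v)
    (hQ_ent : Integrable (fun x => Q x * Real.log (Q x)))
    (hpN_int : Integrable (fun x => Q x * Real.log (pN (x (Fin.last N)))))
    (μ : Fin N → (Fin d → ℝ) → (Fin d → ℝ)) (σ2 : Fin N → ℝ) (hσ : ∀ n, 0 < σ2 n)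
    (hI : ∀ n : Fin N,
      Integrable (fun x => Q x * ∑ i, (x n.castSucc i - μ n (x n.succ) i) ^ 2)) :
    ∫ x, Q x * Real.log (Q x / revJoint d N pN μ σ2 x)
      = (∫ x, Q x * Real.log (Q x)) - (∫ x, Q x * Real.log (pN (x (Fin.last N))))
        + ∑ n, ((d / 2 : ℝ) * Real.log (2 * Real.pi * σ2 n)
          + 1 / (2 * σ2 n) * ∫ x, Q x * ∑ i, (x n.castSucc i - μ n (x n.succ) i) ^ 2) := by
  simp_rw [fun x => aux_log (Q x) (hQ_pos x) pN hpN_pos μ σ2 hσ x]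
  have i1 : Integrable (fun x => Q x * Real.log (Q x) - Q x * Real.log (pN (x (Fin.last N)))) :=
    hQ_ent.sub hpN_int
  have i2 : Integrable (fun x => Q x * Real.log (Q x) - Q x * Real.log (pN (x (Fin.last N)))
        + Q x * (∑ n, (d / 2 : ℝ) * Real.log (2 * Real.pi * σ2 n))) := i1.add (hQ.mul_const _)
  rw [integral_add i2 (integrable_finsetSum _ fun n _ => (hI n).const_mul _),
    integral_add i1 (hQ.mul_const _), integral_sub hQ_ent hpN_int, integral_mul_const, hQ_one,
    integral_finsetSum _ fun n _ => (hI n).const_mul _]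
  simp_rw [integral_const_mul]
  rw [Finset.sum_add_distrib]
  ring

/-- moment matching.  For a joint density `Q` with finite second moments, the KL
divergence `D_KL(Q ‖ p)` over Gaussian Markov reverse chains `p` with fixed `p(x_N) = pN` is
minimized by matching the first two moments of the conditionals `q(x_{n−1}|xₙ)`:
`μₙ* = E[x_{n−1}|xₙ]`, `σₙ*² = E_{qₙ}[tr Cov(x_{n−1}|xₙ)/d]`, and the optimal value is
`H(q(x_N), pN) + (d/2) ∑ₙ log(2πe σₙ*²) − H(Q)`. -/
theorem stmt_8 {N d : ℕ} (hd : 0 < d) (Q : (Fin (N + 1) → Fin d → ℝ) → ℝ)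
    (hQ_nonneg : ∀ x, 0 ≤ Q x) (hQ_meas : Measurable Q) (hQ_one : ∫ x, Q x = 1)
    (hmom2 : ∀ j : Fin (N + 1), Integrable (fun x => Q x * ∑ i, (x j i) ^ 2))
    (hpos : ∀ (s : Finset (Fin (N + 1))) (x : Fin (N + 1) → Fin d → ℝ), 0 < marg Q s x)
    (pN : (Fin d → ℝ) → ℝ) (hpN_pos : ∀ v, 0 < pN v) (hpN_meas : Measurable pN)
    (hpN_one : ∫ v, pN v = 1)
    (hQ_ent : Integrable (fun x => Q x * Real.log (Q x)))
    (hpN_int : Integrable (fun x => Q x * Real.log (pN (x (Fin.last N)))))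
    (hσ_pos : ∀ n : Fin N, 0 < sigmaStar2 Q n)
    (hopt_int : Integrable (fun x =>
      Q x * Real.log (Q x / revJoint d N pN (muStar Q) (sigmaStar2 Q) x))) :
    (∀ (μ : Fin N → (Fin d → ℝ) → (Fin d → ℝ)) (σ2 : Fin N → ℝ),
      (∀ n, Measurable (μ n)) → (∀ n, 0 < σ2 n) →
      Integrable (fun x => Q x * Real.log (Q x / revJoint d N pN μ σ2 x)) →
      (∫ x, Q x * Real.log (Q x / revJoint d N pN (muStar Q) (sigmaStar2 Q) x))
        ≤ ∫ x, Q x * Real.log (Q x / revJoint d N pN μ σ2 x)) ∧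
    (∫ x, Q x * Real.log (Q x / revJoint d N pN (muStar Q) (sigmaStar2 Q) x))
      = (- ∫ x, Q x * Real.log (pN (x (Fin.last N))))
        + (d / 2 : ℝ) * ∑ n : Fin N, Real.log (2 * Real.pi * Real.exp 1 * sigmaStar2 Q n)
        - (- ∫ x, Q x * Real.log (Q x)) := by
  have hQ_pos : ∀ x, 0 < Q x := by
    intro x
    have := hpos univ x
    unfold marg at this
    have hE : IsEmpty {i : Fin (N + 1) // i ∉ (univ : Finset (Fin (N + 1)))} :=
      ⟨fun i => i.2 (Finset.mem_univ _)⟩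
    simpa [volume_pi, Measure.pi_of_empty] using this
  have hQ : Integrable Q := by
    by_contra h
    rw [integral_undef h] at hQ_one
    exact zero_ne_one hQ_one
  have hd' : (0 : ℝ) < d := by exact_mod_cast hd
  have hstar : ∀ n : Fin N, Integrable
      (fun x => Q x * ∑ i, (x n.castSucc i - muStar Q n (x n.succ) i) ^ 2) := by
    intro n
    by_contra h
    have := hσ_pos n
    unfold sigmaStar2 at this
    rw [integral_undef h] at this
    simp at this
  have hsig : ∀ n : Fin N, ∫ x, Q x * ∑ i, (x n.castSucc i - muStar Q n (x n.succ) i) ^ 2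
      = d * sigmaStar2 Q n := by
    intro n
    unfold sigmaStar2
    field_simp
  rw [aux_val Q hQ_pos hQ_one hQ pN hpN_pos hQ_ent hpN_int _ _ hσ_pos hstar]
  refine ⟨?_, ?_⟩
  · intro μ σ2 hμ hσ hint
    have hsum : Integrable (fun x => ∑ n : Fin N,
        1 / (2 * σ2 n) * (Q x * ∑ i, (x n.castSucc i - μ n (x n.succ) i) ^ 2)) := by
      have := (hint.sub (hQ_ent.sub hpN_int)).sub
        (hQ.mul_const (∑ n, (d / 2 : ℝ) * Real.log (2 * Real.pi * σ2 n)))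
      refine this.congr (Filter.Eventually.of_forall fun x => ?_)
      simp only [Pi.sub_apply]
      rw [aux_log (Q x) (hQ_pos x) pN hpN_pos μ σ2 hσ x]
      ring
    have hnn : ∀ (n : Fin N) x,
        0 ≤ 1 / (2 * σ2 n) * (Q x * ∑ i, (x n.castSucc i - μ n (x n.succ) i) ^ 2) := by
      intro n x
      have := hσ n
      have := hQ_nonneg x
      positivity
    have hI : ∀ n : Fin N,
        Integrable (fun x => Q x * ∑ i, (x n.castSucc i - μ n (x n.succ) i) ^ 2) := by
      intro n
      have h1 : Integrable (fun x =>
          1 / (2 * σ2 n) * (Q x * ∑ i, (x n.castSucc i - μ n (x n.succ) i) ^ 2)) := by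
        refine hsum.mono' ?_ (Filter.Eventually.of_forall fun x => ?_)
        · have := hμ n
          fun_prop
        · rw [Real.norm_of_nonneg (hnn n x)]
          exact Finset.single_le_sum (f := fun n : Fin N =>
            1 / (2 * σ2 n) * (Q x * ∑ i, (x n.castSucc i - μ n (x n.succ) i) ^ 2))
            (fun n _ => hnn n x) (Finset.mem_univ n)
      refine (h1.const_mul (2 * σ2 n)).congr (Filter.Eventually.of_forall fun x => ?_)
      have := (hσ n).ne'
      field_simp
    rw [aux_val Q hQ_pos hQ_one hQ pN hpN_pos hQ_ent hpN_int _ _ hσ hI]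
    refine add_le_add le_rfl (Finset.sum_le_sum fun n _ => ?_)
    have hle := aux_proj Q hQ_nonneg hQ_meas hQ hmom2 hpos n (hstar n) (μ n) (hI n)
    rw [hsig n] at hle ⊢
    have hs := hσ n
    have ht := hσ_pos n
    set s := σ2 n
    set t := sigmaStar2 Q n
    have h1 : 1 / (2 * s) * (d * t) ≤ 1 / (2 * s) *
        ∫ x, Q x * ∑ i, (x n.castSucc i - μ n (x n.succ) i) ^ 2 := by gcongr
    have h2 := Real.log_le_sub_one_of_pos (div_pos ht hs)
    rw [Real.log_div ht.ne' hs.ne'] at h2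
    have hpi := Real.pi_pos
    rw [Real.log_mul (by positivity) ht.ne', Real.log_mul (by positivity) hs.ne']
    have h3 : 1 / (2 * t) * (d * t) = d / 2 := by field_simp
    have h4 : 1 / (2 * s) * (d * t) = d / 2 * (t / s) := by field_simp
    rw [h3]
    rw [h4] at h1
    nlinarith [mul_le_mul_of_nonneg_left h2 (half_pos hd').le]
  · rw [Finset.mul_sum]
    have : ∀ n : Fin N, (d / 2 : ℝ) * Real.log (2 * Real.pi * sigmaStar2 Q n)
          + 1 / (2 * sigmaStar2 Q n) *
            ∫ x, Q x * ∑ i, (x n.castSucc i - muStar Q n (x n.succ) i) ^ 2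
        = (d / 2 : ℝ) * Real.log (2 * Real.pi * Real.exp 1 * sigmaStar2 Q n) := by
      intro n
      have ht := hσ_pos n
      have hpi := Real.pi_pos
      rw [hsig n, show 2 * Real.pi * Real.exp 1 * sigmaStar2 Q n
        = 2 * Real.pi * sigmaStar2 Q n * Real.exp 1 by ring,
        Real.log_mul (by positivity) (Real.exp_pos 1).ne', Real.log_exp]
      field_simp
    rw [Finset.sum_congr rfl fun n _ => this n]
    ring
end

section
/- Let q(v, w) = q(v) q(w | v) be a joint density on ℝ^d × ℝ^d with q(w | v) = N(w | √α v, β I) for scalars α, β > 0, and let q(w) denote the marginal density of w. Then: (i) E_{q(v|w)}[v] = (1/√α)(w + β ∇_w log q(w)); (ii) E_{q(w)}[Cov_{q(v|w)}[v]] = (β/α)(I − β E_{q(w)}[∇_w log q(w) ∇_w log q(w)ᵀ]); and (iii) E_{q(w)}[tr(Cov_{q(v|w)}[v])/d] = (β/α)(1 − β E_{q(w)}[‖∇_w log q(w)‖²/d]). -/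
open MeasureTheory

/-- Isotropic Gaussian density `N(μ, s·I)` on `ℝ^d` (Euclidean space). -/
noncomputable def gaussIsoE (d : ℕ) (μ : EuclideanSpace ℝ (Fin d)) (s : ℝ)
    (x : EuclideanSpace ℝ (Fin d)) : ℝ :=
  (2 * Real.pi * s) ^ (-(d : ℝ) / 2) * Real.exp (-‖x - μ‖ ^ 2 / (2 * s))

/-- Joint density `q(v, w) = q(v) N(w | √α v, β I)`. -/
noncomputable def jointVW (d : ℕ) (qv : EuclideanSpace ℝ (Fin d) → ℝ) (α β : ℝ)
    (v w : EuclideanSpace ℝ (Fin d)) : ℝ :=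
  qv v * gaussIsoE d (Real.sqrt α • v) β w

/-- Marginal density `q(w) = ∫ q(v, w) dv`. -/
noncomputable def margW (d : ℕ) (qv : EuclideanSpace ℝ (Fin d) → ℝ) (α β : ℝ)
    (w : EuclideanSpace ℝ (Fin d)) : ℝ :=
  ∫ v, jointVW d qv α β v w

/-- Conditional mean `E_{q(v|w)}[v]`. -/
noncomputable def condMeanV (d : ℕ) (qv : EuclideanSpace ℝ (Fin d) → ℝ) (α β : ℝ)
    (w : EuclideanSpace ℝ (Fin d)) : EuclideanSpace ℝ (Fin d) :=
  (margW d qv α β w)⁻¹ • ∫ v, jointVW d qv α β v w • v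

/-- Score function `∇_w log q(w)` of the marginal. -/
noncomputable def scoreW (d : ℕ) (qv : EuclideanSpace ℝ (Fin d) → ℝ) (α β : ℝ)
    (w : EuclideanSpace ℝ (Fin d)) : EuclideanSpace ℝ (Fin d) :=
  gradient (fun y => Real.log (margW d qv α β y)) w

open ProbabilityTheory in
lemma aux_gauss_prod {d : ℕ} (b : NNReal) (hb : 0 < b) (x : EuclideanSpace ℝ (Fin d)) :
    gaussIsoE d 0 b x = ∏ k, gaussianPDFReal 0 b (x k) := by
  unfold gaussIsoE gaussianPDFReal
  rw [Finset.prod_mul_distrib, ← Real.exp_sum]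
  congr 1
  · have hp : (0:ℝ) < 2 * Real.pi * b := by positivity
    rw [Finset.prod_const, Real.sqrt_eq_rpow, ← Real.rpow_neg hp.le, ← Real.rpow_natCast,
      ← Real.rpow_mul hp.le]
    congr 1
    simp
    ring
  · congr 1
    rw [sub_zero, EuclideanSpace.norm_sq_eq, ← Finset.sum_div, Finset.sum_neg_distrib]
    simp

open ProbabilityTheory in
lemma aux_pdf_int (b : NNReal) (hb : 0 < b) (n : ℕ) :
    Integrable (fun x : ℝ => gaussianPDFReal 0 b x * x ^ n) := by
  have h := integrable_rpow_mul_exp_neg_mul_sq (b := (2 * (b:ℝ))⁻¹) (by positivity)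
    (s := n) (by have : (0:ℝ) ≤ n := by positivity
                 linarith)
  refine (h.const_mul ((√(2 * Real.pi * b))⁻¹)).congr (ae_of_all _ fun x => ?_)
  simp only [gaussianPDFReal, Real.rpow_natCast, sub_zero]
  rw [show -x ^ 2 / (2 * (b:ℝ)) = -(2 * (b:ℝ))⁻¹ * x ^ 2 by ring]
  ring

open ProbabilityTheory in
lemma aux_pdf_one (b : NNReal) (hb : 0 < b) :
    ∫ x : ℝ, gaussianPDFReal 0 b x * x = 0 := by
  have := integral_gaussianReal_eq_integral_smul (μ := 0) (v := b) (f := fun x : ℝ => x) hb.ne'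
  rw [integral_id_gaussianReal] at this
  simpa using this.symm

open ProbabilityTheory in
lemma aux_pdf_two (b : NNReal) (hb : 0 < b) :
    ∫ x : ℝ, gaussianPDFReal 0 b x * x * x = b := by
  have := integral_gaussianReal_eq_integral_smul (μ := 0) (v := b) (f := fun x : ℝ => x ^ 2) hb.ne'
  have h2 := variance_fun_id_gaussianReal (μ := 0) (v := b)
  rw [variance_eq_integral measurable_id'.aemeasurable] at h2
  simp only [integral_id_gaussianReal, sub_zero] at h2
  rw [← h2, this]
  congr 1; ext x; simp; ring

open ProbabilityTheory in
lemma aux_h {d : ℕ} (b : NNReal) (hb : 0 < b) (i j : Fin d) :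
    Integrable (fun x : EuclideanSpace ℝ (Fin d) => gaussIsoE d 0 b x * (x i * x j)) ∧
    ∫ x : EuclideanSpace ℝ (Fin d), gaussIsoE d 0 b x * (x i * x j)
      = b * (if i = j then (1 : ℝ) else 0) := by
  set f : Fin d → ℝ → ℝ := fun k x =>
    gaussianPDFReal 0 b x * (if k = i then x else 1) * (if k = j then x else 1) with hf
  have hfi : ∀ k, Integrable (f k) := by
    intro k
    by_cases h1 : k = i <;> by_cases h2 : k = j
    · exact (aux_pdf_int b hb 2).congr (ae_of_all _ fun x => by simp only [hf, if_pos h1, if_pos h2]; ring)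
    · exact (aux_pdf_int b hb 1).congr (ae_of_all _ fun x => by simp only [hf, if_pos h1, if_neg h2]; ring)
    · exact (aux_pdf_int b hb 1).congr (ae_of_all _ fun x => by simp only [hf, if_neg h1, if_pos h2]; ring)
    · exact (aux_pdf_int b hb 0).congr (ae_of_all _ fun x => by simp only [hf, if_neg h1, if_neg h2]; ring)
  have heq : ∀ y : Fin d → ℝ, gaussIsoE d 0 b (WithLp.toLp 2 y) *
      ((WithLp.toLp 2 y : EuclideanSpace ℝ (Fin d)) i * (WithLp.toLp 2 y : EuclideanSpace ℝ (Fin d)) j)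
      = ∏ k, f k (y k) := by
    intro y
    rw [aux_gauss_prod b hb]
    simp only [hf, Finset.prod_mul_distrib]
    simp
    ring
  have hmp := PiLp.volume_preserving_toLp (Fin d)
  have hme : MeasurableEmbedding (WithLp.toLp 2 : (Fin d → ℝ) → EuclideanSpace ℝ (Fin d)) :=
    (MeasurableEquiv.toLp 2 (Fin d → ℝ)).measurableEmbedding
  constructor
  · rw [← hmp.integrable_comp_emb hme]
    exact (Integrable.fintype_prod hfi).congr (ae_of_all _ fun y => (heq y).symm)
  · rw [← hmp.integral_comp hme]
    simp_rw [heq]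
    rw [integral_fintype_prod_volume_eq_prod]
    by_cases hij : i = j
    · subst hij
      rw [Finset.prod_eq_single i]
      · simp [hf, aux_pdf_two b hb]
      · intro k _ hk
        simp [hf, hk, integral_gaussianPDFReal_eq_one 0 hb.ne']
      · simp
    · rw [Finset.prod_eq_zero (Finset.mem_univ i)]
      · simp [hij]
      · simp [hf, hij, aux_pdf_one b hb]

lemma aux_gauss_shift {d : ℕ} (β : ℝ) (μ w : EuclideanSpace ℝ (Fin d)) :
    gaussIsoE d μ β w = gaussIsoE d 0 β (w - μ) := by
  simp [gaussIsoE]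

lemma aux_gauss_pos {d : ℕ} {β : ℝ} (hβ : 0 < β) (μ w : EuclideanSpace ℝ (Fin d)) :
    0 < gaussIsoE d μ β w := by
  unfold gaussIsoE; positivity

lemma aux_gauss_le {d : ℕ} {β : ℝ} (hβ : 0 < β) (μ w : EuclideanSpace ℝ (Fin d)) :
    gaussIsoE d μ β w ≤ (2 * Real.pi * β) ^ (-(d : ℝ) / 2) := by
  unfold gaussIsoE
  apply mul_le_of_le_one_right (by positivity)
  rw [Real.exp_le_one_iff, neg_div]
  have : 0 ≤ ‖w - μ‖ ^ 2 / (2 * β) := by positivity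
  linarith

lemma aux_gauss_cont {d : ℕ} (α β : ℝ) :
    Continuous (fun p : EuclideanSpace ℝ (Fin d) × EuclideanSpace ℝ (Fin d) =>
      gaussIsoE d (Real.sqrt α • p.1) β p.2) := by
  unfold gaussIsoE; fun_prop

lemma aux_joint_meas {d : ℕ} (α β : ℝ) (qv : EuclideanSpace ℝ (Fin d) → ℝ)
    (hm : Measurable qv) :
    Measurable (fun p : EuclideanSpace ℝ (Fin d) × EuclideanSpace ℝ (Fin d) =>
      jointVW d qv α β p.1 p.2) := by
  unfold jointVW
  exact (hm.comp measurable_fst).mul (aux_gauss_cont α β).measurable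

lemma aux_joint_meas_left {d : ℕ} (α β : ℝ) (qv : EuclideanSpace ℝ (Fin d) → ℝ)
    (hm : Measurable qv) (w : EuclideanSpace ℝ (Fin d)) :
    Measurable (fun v : EuclideanSpace ℝ (Fin d) => jointVW d qv α β v w) :=
  (aux_joint_meas α β qv hm).comp (measurable_id.prodMk measurable_const)

lemma aux_joint_nonneg {d : ℕ} {α β : ℝ} (hβ : 0 < β) {qv : EuclideanSpace ℝ (Fin d) → ℝ}
    (hn : ∀ v, 0 ≤ qv v) (v w) : 0 ≤ jointVW d qv α β v w :=
  mul_nonneg (hn v) (aux_gauss_pos hβ _ _).le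

lemma aux_q_int {d : ℕ} {qv : EuclideanSpace ℝ (Fin d) → ℝ} (h1 : ∫ v, qv v = 1) :
    Integrable qv := by
  by_contra h
  rw [integral_undef h] at h1
  exact zero_ne_one h1

lemma aux_int {d : ℕ} {α β : ℝ} (hβ : 0 < β) {qv : EuclideanSpace ℝ (Fin d) → ℝ}
    (hn : ∀ v, 0 ≤ qv v) (hm : Measurable qv) (h1 : ∫ v, qv v = 1)
    (h2 : Integrable (fun v => qv v * ‖v‖ ^ 2)) {F : Type*} [NormedAddCommGroup F]
    [NormedSpace ℝ F] (w : EuclideanSpace ℝ (Fin d)) (g : EuclideanSpace ℝ (Fin d) → F)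
    (hg : AEStronglyMeasurable g) (K : ℝ) (hK : ∀ v, ‖g v‖ ≤ K * (1 + ‖v‖ ^ 2)) :
    Integrable (fun v => jointVW d qv α β v w • g v) := by
  have hb : Integrable (fun v => (2 * Real.pi * β) ^ (-(d : ℝ) / 2) * K *
      (qv v + qv v * ‖v‖ ^ 2)) := ((aux_q_int h1).add h2).const_mul _
  refine hb.mono' ((aux_joint_meas_left α β qv hm w).aestronglyMeasurable.smul hg)
    (ae_of_all _ fun v => ?_)
  rw [norm_smul, Real.norm_of_nonneg (aux_joint_nonneg hβ hn v w)]
  unfold jointVW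
  calc qv v * gaussIsoE d (Real.sqrt α • v) β w * ‖g v‖
      ≤ qv v * (2 * Real.pi * β) ^ (-(d : ℝ) / 2) * (K * (1 + ‖v‖ ^ 2)) := by
        gcongr
        · exact mul_nonneg (hn v) (by positivity)
        · exact hn v
        · exact aux_gauss_le hβ _ _
        · exact hK v
    _ = _ := by ring

lemma aux_joint_int {d : ℕ} {α β : ℝ} (hβ : 0 < β) {qv : EuclideanSpace ℝ (Fin d) → ℝ}
    (hn : ∀ v, 0 ≤ qv v) (hm : Measurable qv) (h1 : ∫ v, qv v = 1)
    (h2 : Integrable (fun v => qv v * ‖v‖ ^ 2)) (w : EuclideanSpace ℝ (Fin d)) :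
    Integrable (fun v => jointVW d qv α β v w) := by
  have := aux_int (α := α) hβ hn hm h1 h2 w (fun _ => (1:ℝ)) aestronglyMeasurable_const 1
    (fun v => by simp)
  simpa using this

lemma aux_marg_pos {d : ℕ} {α β : ℝ} (hβ : 0 < β) {qv : EuclideanSpace ℝ (Fin d) → ℝ}
    (hn : ∀ v, 0 ≤ qv v) (hm : Measurable qv) (h1 : ∫ v, qv v = 1)
    (h2 : Integrable (fun v => qv v * ‖v‖ ^ 2)) (w : EuclideanSpace ℝ (Fin d)) :
    0 < margW d qv α β w := by
  unfold margW
  rw [integral_pos_iff_support_of_nonneg (fun v => aux_joint_nonneg hβ hn v w)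
    (aux_joint_int hβ hn hm h1 h2 w)]
  have hs : Function.support (fun v => jointVW d qv α β v w) = Function.support qv := by
    ext v
    simp [jointVW, (aux_gauss_pos hβ (Real.sqrt α • v) w).ne']
  rw [hs, ← integral_pos_iff_support_of_nonneg hn (aux_q_int h1), h1]
  exact one_pos

lemma aux_lin_le (a : ℝ) {c : ℝ} {d : ℕ} (w v : EuclideanSpace ℝ (Fin d)) (hw : ‖w‖ ≤ c) :
    ‖w - a • v‖ ≤ (c + |a|) * (1 + ‖v‖ ^ 2) := by
  have h1 : ‖w - a • v‖ ≤ ‖w‖ + |a| * ‖v‖ := by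
    refine (norm_sub_le _ _).trans ?_
    rw [norm_smul, Real.norm_eq_abs]
  have h3 : ‖v‖ ≤ 1 + ‖v‖ ^ 2 := by nlinarith [sq_nonneg (‖v‖ - 1)]
  have h4 := mul_le_mul_of_nonneg_left h3 (abs_nonneg a)
  have h5 : 0 ≤ c := (norm_nonneg _).trans hw
  nlinarith [mul_nonneg h5 (sq_nonneg ‖v‖)]

lemma aux_grad {d : ℕ} {α β : ℝ} (hβ : 0 < β) {qv : EuclideanSpace ℝ (Fin d) → ℝ}
    (hn : ∀ v, 0 ≤ qv v) (hm : Measurable qv) (h1 : ∫ v, qv v = 1)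
    (h2 : Integrable (fun v => qv v * ‖v‖ ^ 2)) (w : EuclideanSpace ℝ (Fin d)) :
    HasGradientAt (margW d qv α β)
      (-(β⁻¹) • ∫ v, jointVW d qv α β v w • (w - Real.sqrt α • v)) w := by
  rw [hasGradientAt_iff_hasFDerivAt]
  have hlin : Integrable (fun v => jointVW d qv α β v w • (w - Real.sqrt α • v)) :=
    aux_int hβ hn hm h1 h2 w _ (by fun_prop) _ (fun v => aux_lin_le _ w v le_rfl)
  set F' : EuclideanSpace ℝ (Fin d) → EuclideanSpace ℝ (Fin d) →
      (EuclideanSpace ℝ (Fin d) →L[ℝ] ℝ) := fun x v =>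
    (-(β⁻¹) * jointVW d qv α β v x) • innerSL ℝ (x - Real.sqrt α • v) with hF'
  have hmeas : AEStronglyMeasurable (F' w) := by
    have hc : Continuous (fun v : EuclideanSpace ℝ (Fin d) =>
      (innerSL ℝ (w - Real.sqrt α • v) : EuclideanSpace ℝ (Fin d) →L[ℝ] ℝ)) :=
      (innerSL ℝ).continuous.comp (by fun_prop)
    exact (((aux_joint_meas_left α β qv hm w).const_mul _).aestronglyMeasurable).smul
      hc.aestronglyMeasurable
  have hF'i : Integrable (F' w) := by
    refine (hlin.norm.const_mul β⁻¹).mono' hmeas (ae_of_all _ fun v => le_of_eq ?_)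
    simp only [hF', norm_smul, norm_mul, norm_neg, innerSL_apply_norm]
    rw [Real.norm_of_nonneg (inv_nonneg.2 hβ.le)]
    ring
  have key := hasFDerivAt_integral_of_dominated_of_fderiv_le (𝕜 := ℝ) (μ := volume)
    (F := fun x v => jointVW d qv α β v x) (F' := F') (x₀ := w)
    (s := Metric.ball w 1)
    (bound := fun v => β⁻¹ * ((2 * Real.pi * β) ^ (-(d : ℝ) / 2) * (‖w‖ + 1 + |Real.sqrt α|)) *
      (qv v + qv v * ‖v‖ ^ 2))
    (Metric.ball_mem_nhds w one_pos)
    (Filter.Eventually.of_forall fun x => (aux_joint_meas_left α β qv hm x).aestronglyMeasurable)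
    (aux_joint_int hβ hn hm h1 h2 w) hmeas
    (ae_of_all _ fun v x hx => ?_) (((aux_q_int h1).add h2).const_mul _)
    (ae_of_all _ fun v x hx => ?_)
  · convert! key using 1
    ext y
    rw [ContinuousLinearMap.integral_apply hF'i]
    simp only [InnerProductSpace.toDual_apply_apply, hF', FunLike.coe_smul, Pi.smul_apply,
      innerSL_apply_apply, smul_eq_mul]
    rw [inner_smul_left, real_inner_comm, ← integral_inner hlin, ← integral_const_mul]
    congr 1
    ext v
    rw [inner_smul_right, real_inner_comm]
    simp
    ring
  · have hxn : ‖x‖ ≤ ‖w‖ + 1 := by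
      have : ‖x - w‖ < 1 := by simpa [dist_eq_norm] using hx
      have := norm_le_norm_add_norm_sub' x w
      linarith
    simp only [hF', norm_smul, norm_mul, norm_neg, innerSL_apply_norm]
    rw [Real.norm_of_nonneg (inv_nonneg.2 hβ.le),
      Real.norm_of_nonneg (aux_joint_nonneg hβ hn v x)]
    unfold jointVW
    calc β⁻¹ * (qv v * gaussIsoE d (Real.sqrt α • v) β x) * ‖x - Real.sqrt α • v‖
        ≤ β⁻¹ * (qv v * (2 * Real.pi * β) ^ (-(d : ℝ) / 2)) *
          ((‖w‖ + 1 + |Real.sqrt α|) * (1 + ‖v‖ ^ 2)) := by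
          have := hn v
          gcongr
          · exact aux_gauss_le hβ _ _
          · exact aux_lin_le _ x v hxn
      _ = _ := by ring
  · have hd : HasFDerivAt (fun x : EuclideanSpace ℝ (Fin d) => ‖x - Real.sqrt α • v‖ ^ 2)
        (2 • (innerSL ℝ (x - Real.sqrt α • v))) x := by
      have := ((hasFDerivAt_id x).sub_const (Real.sqrt α • v)).norm_sq
      simpa using this
    have h3 := (((hd.neg.mul_const (2 * β)⁻¹).exp).const_mul
      ((2 * Real.pi * β) ^ (-(d : ℝ) / 2))).const_mul (qv v)
    have e1 : (fun x => jointVW d qv α β v x) = (fun x => qv v * ((2 * Real.pi * β) ^ (-(d : ℝ) / 2)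
        * Real.exp (-‖x - Real.sqrt α • v‖ ^ 2 * (2 * β)⁻¹))) := by
      ext x; simp [jointVW, gaussIsoE, div_eq_mul_inv]
    rw [e1]
    convert! h3 using 1
    ext y
    simp [hF', jointVW, gaussIsoE, div_eq_mul_inv]
    ring

lemma aux_int_smul_v {d : ℕ} {α β : ℝ} (hβ : 0 < β) {qv : EuclideanSpace ℝ (Fin d) → ℝ}
    (hn : ∀ v, 0 ≤ qv v) (hm : Measurable qv) (h1 : ∫ v, qv v = 1)
    (h2 : Integrable (fun v => qv v * ‖v‖ ^ 2)) (w : EuclideanSpace ℝ (Fin d)) :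
    Integrable (fun v => jointVW d qv α β v w • v) := by
  refine aux_int hβ hn hm h1 h2 w _ (by fun_prop) 1 (fun v => ?_)
  nlinarith [sq_nonneg (‖v‖ - 1)]

lemma aux_score {d : ℕ} {α β : ℝ} (hβ : 0 < β) {qv : EuclideanSpace ℝ (Fin d) → ℝ}
    (hn : ∀ v, 0 ≤ qv v) (hm : Measurable qv) (h1 : ∫ v, qv v = 1)
    (h2 : Integrable (fun v => qv v * ‖v‖ ^ 2)) (w : EuclideanSpace ℝ (Fin d)) :
    scoreW d qv α β w = -(β⁻¹) • (w - Real.sqrt α • condMeanV d qv α β w) := by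
  have hp := aux_marg_pos (α := α) hβ hn hm h1 h2 w
  have hg := (aux_grad (α := α) hβ hn hm h1 h2 w)
  have hl : HasGradientAt (fun y => Real.log (margW d qv α β y))
      ((margW d qv α β w)⁻¹ • (-(β⁻¹) • ∫ v, jointVW d qv α β v w • (w - Real.sqrt α • v))) w := by
    rw [hasGradientAt_iff_hasFDerivAt] at hg ⊢
    have := hg.log hp.ne'
    convert! this using 1
    simp
  unfold scoreW
  rw [hl.gradient]
  have e : ∫ v, jointVW d qv α β v w • (w - Real.sqrt α • v) =
      margW d qv α β w • w - Real.sqrt α • ∫ v, jointVW d qv α β v w • v := by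
    simp_rw [smul_sub]
    rw [integral_sub ((aux_joint_int hβ hn hm h1 h2 w).smul_const w)]
    · rw [integral_smul_const, ← integral_smul]
      congr 2
      ext1 v
      rw [smul_comm]
    · simp_rw [smul_comm _ (Real.sqrt α)]
      exact (aux_int_smul_v hβ hn hm h1 h2 w).smul (Real.sqrt α)
  rw [e]
  unfold condMeanV
  rw [smul_comm, smul_sub, smul_smul, inv_mul_cancel₀ hp.ne', one_smul, smul_comm (Real.sqrt α)]

lemma aux_coord_le {d : ℕ} (x : EuclideanSpace ℝ (Fin d)) (i : Fin d) : |x i| ≤ ‖x‖ := by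
  simpa using PiLp.norm_apply_le x i

lemma aux_int_cross {d : ℕ} {α β : ℝ} (hβ : 0 < β) {qv : EuclideanSpace ℝ (Fin d) → ℝ}
    (hn : ∀ v, 0 ≤ qv v) (hm : Measurable qv) (h1 : ∫ v, qv v = 1)
    (h2 : Integrable (fun v => qv v * ‖v‖ ^ 2)) (w m : EuclideanSpace ℝ (Fin d)) (i j : Fin d) :
    Integrable (fun v => jointVW d qv α β v w * ((v i - m i) * (v j - m j))) := by
  refine aux_int hβ hn hm h1 h2 w (fun v => (v i - m i) * (v j - m j)) (by fun_prop)
    (2 + 2 * ‖m‖ ^ 2) (fun v => ?_)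
  have a1 := aux_coord_le (v - m) i
  have a2 := aux_coord_le (v - m) j
  have a3 := norm_sub_le v m
  simp only [PiLp.sub_apply] at a1 a2
  rw [norm_mul, Real.norm_eq_abs, Real.norm_eq_abs]
  have a4 : |v i - m i| * |v j - m j| ≤ (‖v‖ + ‖m‖) * (‖v‖ + ‖m‖) := by
    gcongr
    · exact a1.trans a3
    · exact a2.trans a3
  nlinarith [sq_nonneg (‖v‖ - ‖m‖), mul_nonneg (sq_nonneg ‖m‖) (sq_nonneg ‖v‖)]

lemma aux_int_lin {d : ℕ} {α β : ℝ} (hβ : 0 < β) {qv : EuclideanSpace ℝ (Fin d) → ℝ}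
    (hn : ∀ v, 0 ≤ qv v) (hm : Measurable qv) (h1 : ∫ v, qv v = 1)
    (h2 : Integrable (fun v => qv v * ‖v‖ ^ 2)) (w m : EuclideanSpace ℝ (Fin d)) (i : Fin d) :
    Integrable (fun v => jointVW d qv α β v w * (v i - m i)) := by
  have h : Integrable (fun v => jointVW d qv α β v w • (v - m)) := by
    simp_rw [smul_sub]
    exact (aux_int_smul_v hβ hn hm h1 h2 w).sub ((aux_joint_int hβ hn hm h1 h2 w).smul_const m)
  have := (EuclideanSpace.proj (𝕜 := ℝ) i).integrable_comp h
  simpa using this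

lemma aux_int_lin_zero {d : ℕ} {α β : ℝ} (hβ : 0 < β) {qv : EuclideanSpace ℝ (Fin d) → ℝ}
    (hn : ∀ v, 0 ≤ qv v) (hm : Measurable qv) (h1 : ∫ v, qv v = 1)
    (h2 : Integrable (fun v => qv v * ‖v‖ ^ 2)) (w : EuclideanSpace ℝ (Fin d)) (i : Fin d) :
    ∫ v, jointVW d qv α β v w * (v i - condMeanV d qv α β w i) = 0 := by
  have hp := aux_marg_pos (α := α) hβ hn hm h1 h2 w
  set m := condMeanV d qv α β w with hmdef
  have h : Integrable (fun v => jointVW d qv α β v w • (v - m)) := by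
    simp_rw [smul_sub]
    exact (aux_int_smul_v hβ hn hm h1 h2 w).sub ((aux_joint_int hβ hn hm h1 h2 w).smul_const m)
  have h0 : ∫ v, jointVW d qv α β v w • (v - m) = 0 := by
    simp_rw [smul_sub]
    rw [integral_sub (aux_int_smul_v hβ hn hm h1 h2 w)
      ((aux_joint_int hβ hn hm h1 h2 w).smul_const m), integral_smul_const]
    change _ - margW d qv α β w • m = 0
    rw [hmdef]
    unfold condMeanV
    rw [smul_smul, mul_inv_cancel₀ hp.ne', one_smul, sub_self]
  have := (EuclideanSpace.proj (𝕜 := ℝ) i).integral_comp_comm h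
  rw [h0] at this
  simpa using this

lemma aux_decomp {d : ℕ} {α β : ℝ} (hα : 0 < α) (hβ : 0 < β) {qv : EuclideanSpace ℝ (Fin d) → ℝ}
    (hn : ∀ v, 0 ≤ qv v) (hm : Measurable qv) (h1 : ∫ v, qv v = 1)
    (h2 : Integrable (fun v => qv v * ‖v‖ ^ 2)) (w : EuclideanSpace ℝ (Fin d)) (i j : Fin d) :
    ∫ v, jointVW d qv α β v w * ((w - Real.sqrt α • v) i * (w - Real.sqrt α • v) j) =
      β ^ 2 * (margW d qv α β w * (scoreW d qv α β w i * scoreW d qv α β w j)) +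
      α * ∫ v, jointVW d qv α β v w *
          ((v i - condMeanV d qv α β w i) * (v j - condMeanV d qv α β w j)) := by
  set m := condMeanV d qv α β w with hmdef
  set s := scoreW d qv α β w with hsdef
  have hs : ∀ k, w k = Real.sqrt α * m k - β * s k := by
    intro k
    rw [hsdef, aux_score hβ hn hm h1 h2 w, ← hmdef]
    simp
    field_simp
    ring
  have hsq : Real.sqrt α * Real.sqrt α = α := Real.mul_self_sqrt hα.le
  have hpt : ∀ v, jointVW d qv α β v w * ((w - Real.sqrt α • v) i * (w - Real.sqrt α • v) j) =
      (((β ^ 2 * (s i * s j)) * jointVW d qv α β v w +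
        (Real.sqrt α * β * s i) * (jointVW d qv α β v w * (v j - m j))) +
        (Real.sqrt α * β * s j) * (jointVW d qv α β v w * (v i - m i))) +
        α * (jointVW d qv α β v w * ((v i - m i) * (v j - m j))) := by
    intro v
    simp only [PiLp.sub_apply, PiLp.smul_apply, smul_eq_mul, hs]
    linear_combination (jointVW d qv α β v w * ((v i - m i) * (v j - m j))) * hsq
  have i0 := (aux_joint_int (α := α) hβ hn hm h1 h2 w).const_mul (β ^ 2 * (s i * s j))
  have i1 := (aux_int_lin (α := α) hβ hn hm h1 h2 w m j).const_mul (Real.sqrt α * β * s i)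
  have i2 := (aux_int_lin (α := α) hβ hn hm h1 h2 w m i).const_mul (Real.sqrt α * β * s j)
  have i3 := (aux_int_cross (α := α) hβ hn hm h1 h2 w m i j).const_mul α
  simp_rw [hpt]
  have i01 := i0.add i1
  have i012 := i01.add i2
  simp only [Pi.add_def] at i01 i012
  rw [integral_add i012 i3, integral_add i01 i2, integral_add i0 i1,
    integral_const_mul, integral_const_mul, integral_const_mul, integral_const_mul,
    aux_int_lin_zero hβ hn hm h1 h2 w i, aux_int_lin_zero hβ hn hm h1 h2 w j]
  simp only [margW]
  ring

lemma aux_prod_int {d : ℕ} {α β : ℝ} (hβ : 0 < β) {qv : EuclideanSpace ℝ (Fin d) → ℝ}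
    (hm : Measurable qv) (h1 : ∫ v, qv v = 1) (i j : Fin d) :
    Integrable (fun p : EuclideanSpace ℝ (Fin d) × EuclideanSpace ℝ (Fin d) =>
      jointVW d qv α β p.1 p.2 *
        ((p.2 - Real.sqrt α • p.1) i * (p.2 - Real.sqrt α • p.1) j)) (volume.prod volume) := by
  have hh := (aux_h (d := d) ⟨β, hβ.le⟩ hβ i j).1
  simp only at hh
  have e : ∀ v w : EuclideanSpace ℝ (Fin d), jointVW d qv α β v w *
        ((w - Real.sqrt α • v) i * (w - Real.sqrt α • v) j) =
      qv v * (fun x : EuclideanSpace ℝ (Fin d) => gaussIsoE d 0 β x * (x i * x j))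
        (w - Real.sqrt α • v) := by
    intro v w
    simp only [jointVW]
    rw [aux_gauss_shift]
    ring
  rw [integrable_prod_iff]
  · constructor
    · refine ae_of_all _ fun v => ?_
      simp only [e]
      exact (hh.comp_sub_right (Real.sqrt α • v)).const_mul (qv v)
    · simp only [e, norm_mul (qv _)]
      simp_rw [integral_const_mul]
      have : ∀ v : EuclideanSpace ℝ (Fin d), ∫ w,
          ‖(fun x : EuclideanSpace ℝ (Fin d) => gaussIsoE d 0 β x * (x i * x j))
            (w - Real.sqrt α • v)‖ = ∫ w : EuclideanSpace ℝ (Fin d),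
              ‖gaussIsoE d 0 β w * (w i * w j)‖ := fun v =>
        integral_sub_right_eq_self
          (fun x : EuclideanSpace ℝ (Fin d) => ‖gaussIsoE d 0 β x * (x i * x j)‖) (Real.sqrt α • v)
      simp_rw [this]
      exact (aux_q_int h1).norm.mul_const _
  · refine ((aux_joint_meas α β qv hm).aestronglyMeasurable).mul ?_
    exact Continuous.aestronglyMeasurable (by fun_prop)

lemma aux_total {d : ℕ} {α β : ℝ} (hβ : 0 < β) {qv : EuclideanSpace ℝ (Fin d) → ℝ}
    (hm : Measurable qv) (h1 : ∫ v, qv v = 1) (i j : Fin d) :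
    ∫ w, ∫ v, jointVW d qv α β v w * ((w - Real.sqrt α • v) i * (w - Real.sqrt α • v) j) =
      β * (if i = j then (1 : ℝ) else 0) := by
  have hh := (aux_h (d := d) ⟨β, hβ.le⟩ hβ i j).2
  change ∫ x : EuclideanSpace ℝ (Fin d), gaussIsoE d 0 β x * (x i * x j)
      = β * (if i = j then (1 : ℝ) else 0) at hh
  have hsw := integral_integral_swap (f := fun v w => jointVW d qv α β v w *
    ((w - Real.sqrt α • v) i * (w - Real.sqrt α • v) j)) (aux_prod_int (α := α) hβ hm h1 i j)
  rw [← hsw]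
  have e : ∀ v : EuclideanSpace ℝ (Fin d), ∫ w, jointVW d qv α β v w *
        ((w - Real.sqrt α • v) i * (w - Real.sqrt α • v) j) =
      qv v * (β * (if i = j then (1 : ℝ) else 0)) := by
    intro v
    rw [← hh, ← integral_sub_right_eq_self
      (fun x : EuclideanSpace ℝ (Fin d) => gaussIsoE d 0 β x * (x i * x j)) (Real.sqrt α • v),
      ← integral_const_mul]
    congr 1
    ext w
    simp only [jointVW]
    rw [aux_gauss_shift]
    ring
  simp_rw [e]
  rw [integral_mul_const, h1, one_mul]

lemma aux_marg_meas {d : ℕ} (α β : ℝ) {qv : EuclideanSpace ℝ (Fin d) → ℝ}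
    (hm : Measurable qv) : Measurable (margW d qv α β) :=
  ((aux_joint_meas α β qv hm).stronglyMeasurable.integral_prod_left').measurable

lemma aux_score_meas {d : ℕ} {α β : ℝ} (hβ : 0 < β) {qv : EuclideanSpace ℝ (Fin d) → ℝ}
    (hn : ∀ v, 0 ≤ qv v) (hm : Measurable qv) (h1 : ∫ v, qv v = 1)
    (h2 : Integrable (fun v => qv v * ‖v‖ ^ 2)) : Measurable (scoreW d qv α β) := by
  have hc : Measurable (fun w => ∫ v, jointVW d qv α β v w • v) :=
    (((aux_joint_meas α β qv hm).smul measurable_fst).stronglyMeasurable.integral_prod_left').measurable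
  have e : scoreW d qv α β = fun w => -(β⁻¹) • (w - Real.sqrt α • condMeanV d qv α β w) :=
    funext fun w => aux_score hβ hn hm h1 h2 w
  rw [e]
  unfold condMeanV
  have := aux_marg_meas α β hm
  fun_prop

lemma aux_score_int_diag {d : ℕ} {α β : ℝ} (hα : 0 < α) (hβ : 0 < β)
    {qv : EuclideanSpace ℝ (Fin d) → ℝ}
    (hn : ∀ v, 0 ≤ qv v) (hm : Measurable qv) (h1 : ∫ v, qv v = 1)
    (h2 : Integrable (fun v => qv v * ‖v‖ ^ 2)) (i : Fin d) :
    Integrable (fun w => margW d qv α β w * (scoreW d qv α β w i * scoreW d qv α β w i)) := by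
  have hs := aux_score_meas (α := α) hβ hn hm h1 h2
  have hmm := aux_marg_meas α β hm
  refine ((aux_prod_int (α := α) hβ hm h1 i i).integral_prod_right.const_mul ((β ^ 2)⁻¹)).mono'
    (Measurable.aestronglyMeasurable (by fun_prop)) (ae_of_all _ fun w => ?_)
  have hp := aux_marg_pos (α := α) hβ hn hm h1 h2 w
  rw [Real.norm_of_nonneg (mul_nonneg hp.le (mul_self_nonneg _))]
  simp only
  rw [aux_decomp hα hβ hn hm h1 h2 w i i]
  have : 0 ≤ ∫ v, jointVW d qv α β v w *
          ((v i - condMeanV d qv α β w i) * (v i - condMeanV d qv α β w i)) :=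
    integral_nonneg fun v => mul_nonneg (aux_joint_nonneg hβ hn v w) (mul_self_nonneg _)
  rw [mul_add, inv_mul_cancel_left₀ (by positivity)]
  have : 0 ≤ (β ^ 2)⁻¹ * (α * ∫ v, jointVW d qv α β v w *
          ((v i - condMeanV d qv α β w i) * (v i - condMeanV d qv α β w i))) := by positivity
  linarith

lemma aux_score_int {d : ℕ} {α β : ℝ} (hα : 0 < α) (hβ : 0 < β)
    {qv : EuclideanSpace ℝ (Fin d) → ℝ}
    (hn : ∀ v, 0 ≤ qv v) (hm : Measurable qv) (h1 : ∫ v, qv v = 1)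
    (h2 : Integrable (fun v => qv v * ‖v‖ ^ 2)) (i j : Fin d) :
    Integrable (fun w => margW d qv α β w * (scoreW d qv α β w i * scoreW d qv α β w j)) := by
  have hs := aux_score_meas (α := α) hβ hn hm h1 h2
  have hmm := aux_marg_meas α β hm
  refine ((aux_score_int_diag hα hβ hn hm h1 h2 i).add
    (aux_score_int_diag hα hβ hn hm h1 h2 j)).mono'
    (Measurable.aestronglyMeasurable (by fun_prop)) (ae_of_all _ fun w => ?_)
  have hp := aux_marg_pos (α := α) hβ hn hm h1 h2 w
  rw [norm_mul, Real.norm_of_nonneg hp.le, Pi.add_apply, ← mul_add]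
  refine mul_le_mul_of_nonneg_left ?_ hp.le
  rw [Real.norm_eq_abs, abs_le]
  constructor <;> nlinarith [sq_nonneg (scoreW d qv α β w i + scoreW d qv α β w j),
    sq_nonneg (scoreW d qv α β w i - scoreW d qv α β w j),
    mul_self_nonneg (scoreW d qv α β w i), mul_self_nonneg (scoreW d qv α β w j)]

lemma aux_cov {d : ℕ} {α β : ℝ} (hα : 0 < α) (hβ : 0 < β)
    {qv : EuclideanSpace ℝ (Fin d) → ℝ}
    (hn : ∀ v, 0 ≤ qv v) (hm : Measurable qv) (h1 : ∫ v, qv v = 1)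
    (h2 : Integrable (fun v => qv v * ‖v‖ ^ 2)) (i j : Fin d) :
    Integrable (fun w => ∫ v, jointVW d qv α β v w *
          ((v i - condMeanV d qv α β w i) * (v j - condMeanV d qv α β w j))) ∧
    (∫ w, ∫ v, jointVW d qv α β v w *
          ((v i - condMeanV d qv α β w i) * (v j - condMeanV d qv α β w j)))
        = (β / α) * ((if i = j then (1 : ℝ) else 0)
            - β * ∫ w, margW d qv α β w * (scoreW d qv α β w i * scoreW d qv α β w j)) := by
  have e : (fun w => ∫ v, jointVW d qv α β v w *
          ((v i - condMeanV d qv α β w i) * (v j - condMeanV d qv α β w j))) =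
      fun w => α⁻¹ * ((∫ v, jointVW d qv α β v w *
        ((w - Real.sqrt α • v) i * (w - Real.sqrt α • v) j)) -
        β ^ 2 * (margW d qv α β w * (scoreW d qv α β w i * scoreW d qv α β w j))) := by
    ext w
    rw [aux_decomp hα hβ hn hm h1 h2 w i j]
    field_simp
    ring
  have iA : Integrable (fun w => ∫ v, jointVW d qv α β v w *
        ((w - Real.sqrt α • v) i * (w - Real.sqrt α • v) j)) :=
    (aux_prod_int (α := α) hβ hm h1 i j).integral_prod_right
  have iB := (aux_score_int hα hβ hn hm h1 h2 i j).const_mul (β ^ 2)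
  rw [e]
  refine ⟨(iA.sub iB).const_mul _, ?_⟩
  rw [integral_const_mul, integral_sub iA iB, integral_const_mul, aux_total hβ hm h1 i j]
  field_simp

/-- for `q(v, w) = q(v) N(w | √α v, β I)` with `α, β > 0` and `q(v)` a density
with finite second moments:
(i) `E_{q(v|w)}[v] = (1/√α)(w + β ∇_w log q(w))`;
(ii) `E_{q(w)}[Cov_{q(v|w)}[v]] = (β/α)(I − β E_{q(w)}[∇ log q(w) ∇ log q(w)ᵀ])` entrywise;
(iii) `E_{q(w)}[tr(Cov_{q(v|w)}[v])/d] = (β/α)(1 − β E_{q(w)}[‖∇ log q(w)‖²/d])`. -/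
theorem stmt_10 {d : ℕ} (hd : 0 < d) (α β : ℝ) (hα : 0 < α) (hβ : 0 < β)
    (qv : EuclideanSpace ℝ (Fin d) → ℝ)
    (hqv_nonneg : ∀ v, 0 ≤ qv v) (hqv_meas : Measurable qv) (hqv_one : ∫ v, qv v = 1)
    (hqv_mom2 : Integrable (fun v => qv v * ‖v‖ ^ 2)) :
    (∀ w, condMeanV d qv α β w = (Real.sqrt α)⁻¹ • (w + β • scoreW d qv α β w)) ∧
    (∀ i j : Fin d,
      (∫ w, ∫ v, jointVW d qv α β v w *
          ((v i - condMeanV d qv α β w i) * (v j - condMeanV d qv α β w j)))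
        = (β / α) * ((if i = j then (1 : ℝ) else 0)
            - β * ∫ w, margW d qv α β w * (scoreW d qv α β w i * scoreW d qv α β w j))) ∧
    ((∫ w, ∫ v, jointVW d qv α β v w * ‖v - condMeanV d qv α β w‖ ^ 2) / d
      = (β / α) * (1 - β * (∫ w, margW d qv α β w * ‖scoreW d qv α β w‖ ^ 2) / d)) := by
  refine ⟨fun w => ?_, fun i j =>
    (aux_cov hα hβ hqv_nonneg hqv_meas hqv_one hqv_mom2 i j).2, ?_⟩
  · rw [aux_score hβ hqv_nonneg hqv_meas hqv_one hqv_mom2 w, smul_smul, mul_neg,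
      mul_inv_cancel₀ hβ.ne', neg_one_smul, neg_sub, add_sub_cancel, smul_smul,
      inv_mul_cancel₀ (Real.sqrt_pos.2 hα).ne', one_smul]
  · have hcov := fun i => aux_cov hα hβ hqv_nonneg hqv_meas hqv_one hqv_mom2 i i
    have e1 : ∀ w, ∫ v, jointVW d qv α β v w * ‖v - condMeanV d qv α β w‖ ^ 2 =
        ∑ i, ∫ v, jointVW d qv α β v w *
          ((v i - condMeanV d qv α β w i) * (v i - condMeanV d qv α β w i)) := by
      intro w
      rw [← integral_finsetSum _ (fun i _ => aux_int_cross hβ hqv_nonneg hqv_meas hqv_one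
        hqv_mom2 w _ i i)]
      congr 1
      ext v
      rw [EuclideanSpace.norm_sq_eq, Finset.mul_sum]
      simp [sq]
    have e2 : ∀ w, margW d qv α β w * ‖scoreW d qv α β w‖ ^ 2 =
        ∑ i, margW d qv α β w * (scoreW d qv α β w i * scoreW d qv α β w i) := by
      intro w
      rw [EuclideanSpace.norm_sq_eq, Finset.mul_sum]
      simp [sq]
    simp_rw [e1, e2]
    rw [integral_finsetSum _ (fun i _ => (hcov i).1), integral_finsetSum _
      (fun i _ => aux_score_int hα hβ hqv_nonneg hqv_meas hqv_one hqv_mom2 i i)]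
    rw [Finset.sum_congr rfl (fun i _ => (hcov i).2)]
    have hd' : (d : ℝ) ≠ 0 := by exact_mod_cast hd.ne'
    rw [← Finset.mul_sum, Finset.sum_sub_distrib, ← Finset.mul_sum]
    simp
    field_simp
end

section
/- For the forward process with marginals q(xₙ | x₀) = N(√ᾱₙ x₀, β̄ₙ I), the expected conditional covariance of the data distribution is determined by the score function: E_{q(xₙ)}[Cov_{q(x₀|xₙ)}[x₀]] = (β̄ₙ/ᾱₙ)(I − β̄ₙ E_{qₙ(xₙ)}[∇_{xₙ} log qₙ(xₙ) ∇_{xₙ} log qₙ(xₙ)ᵀ]), and it contributes to the data covariance via the law of total variance: Cov_{q(x₀)}[x₀] = E_{q(xₙ)}[Cov_{q(x₀|xₙ)}[x₀]] + Cov_{q(xₙ)}[E_{q(x₀|xₙ)}[x₀]]. -/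
open MeasureTheory

/-- Joint density of `(x₀, xₙ)` for the forward marginal `q(xₙ|x₀) = N(√ᾱ x₀, β̄ I)`. -/
noncomputable def joint0n (d : ℕ) (q0 : EuclideanSpace ℝ (Fin d) → ℝ) (ab : ℝ)
    (x0 xn : EuclideanSpace ℝ (Fin d)) : ℝ :=
  q0 x0 * gaussIsoE d (Real.sqrt ab • x0) (1 - ab) xn

/-- The marginal density `qₙ(xₙ)`. -/
noncomputable def margN (d : ℕ) (q0 : EuclideanSpace ℝ (Fin d) → ℝ) (ab : ℝ)
    (xn : EuclideanSpace ℝ (Fin d)) : ℝ :=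
  ∫ x0, joint0n d q0 ab x0 xn

/-- The conditional mean `E_{q(x₀|xₙ)}[x₀]`. -/
noncomputable def condMean0 (d : ℕ) (q0 : EuclideanSpace ℝ (Fin d) → ℝ) (ab : ℝ)
    (xn : EuclideanSpace ℝ (Fin d)) : EuclideanSpace ℝ (Fin d) :=
  (margN d q0 ab xn)⁻¹ • ∫ x0, joint0n d q0 ab x0 xn • x0

/-- The score function `∇_{xₙ} log qₙ(xₙ)`. -/
noncomputable def scoreN (d : ℕ) (q0 : EuclideanSpace ℝ (Fin d) → ℝ) (ab : ℝ)
    (xn : EuclideanSpace ℝ (Fin d)) : EuclideanSpace ℝ (Fin d) :=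
  gradient (fun y => Real.log (margN d q0 ab y)) xn

/-- The data mean `E_{q(x₀)}[x₀]`. -/
noncomputable def dataMean (d : ℕ) (q0 : EuclideanSpace ℝ (Fin d) → ℝ) :
    EuclideanSpace ℝ (Fin d) :=
  ∫ x0, q0 x0 • x0

open ProbabilityTheory in
lemma gk_moments (v : NNReal) (hv : v ≠ 0) :
    (Integrable (fun x : ℝ => gaussianPDFReal 0 v x * 1) ∧ ∫ x : ℝ, gaussianPDFReal 0 v x * 1 = 1) ∧
    (Integrable (fun x : ℝ => gaussianPDFReal 0 v x * x) ∧ ∫ x : ℝ, gaussianPDFReal 0 v x * x = 0) ∧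
    (Integrable (fun x : ℝ => gaussianPDFReal 0 v x * (x * x)) ∧
      ∫ x : ℝ, gaussianPDFReal 0 v x * (x * x) = v) := by
  have key : ∀ f : ℝ → ℝ, Integrable f (gaussianReal 0 v) →
      Integrable (fun x : ℝ => gaussianPDFReal 0 v x * f x) := by
    intro f hf
    rw [gaussianReal_of_var_ne_zero 0 hv, integrable_withDensity_iff_integrable_smul'
      (measurable_gaussianPDF 0 v) (ae_of_all _ fun _ => gaussianPDF_lt_top)] at hf
    simpa [toReal_gaussianPDF] using hf
  have hint : ∀ f : ℝ → ℝ, ∫ x : ℝ, gaussianPDFReal 0 v x * f x = ∫ x, f x ∂(gaussianReal 0 v) := by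
    intro f
    rw [integral_gaussianReal_eq_integral_smul hv]; simp
  have h2 : MemLp id 2 (gaussianReal 0 v) := memLp_id_gaussianReal' 2 (by simp)
  refine ⟨⟨key _ (integrable_const 1), ?_⟩, ⟨key _ ?_, ?_⟩, key _ ?_, ?_⟩
  · rw [hint fun _ => 1]; simp
  · exact h2.integrable (by norm_num)
  · rw [hint fun x => x]; simp
  · simpa [sq] using h2.integrable_sq
  · rw [hint fun x => x * x]
    have := variance_fun_id_gaussianReal (μ := 0) (v := v)
    rw [variance_eq_integral measurable_id'.aemeasurable] at this
    simpa [sq] using this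

open ProbabilityTheory in
lemma gaussIso_prod (d : ℕ) (v : NNReal) (hv : v ≠ 0) (w : EuclideanSpace ℝ (Fin d)) :
    gaussIsoE d 0 v w = ∏ l, gaussianPDFReal 0 v (w l) := by
  have hv' : (0:ℝ) < v := by positivity
  have hp : (0:ℝ) < 2 * Real.pi * v := by positivity
  simp only [gaussIsoE, gaussianPDFReal, Finset.prod_mul_distrib, ← Real.exp_sum, Finset.prod_const,
    sub_zero, EuclideanSpace.norm_sq_eq, Finset.card_univ, Fintype.card_fin]
  congr 1
  · rw [Real.sqrt_eq_rpow, ← Real.rpow_neg hp.le, ← Real.rpow_natCast, ← Real.rpow_mul hp.le]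
    congr 1; ring
  · rw [← Finset.sum_div, Finset.sum_neg_distrib]; simp

open ProbabilityTheory in
lemma gaussIso_int (d : ℕ) (v : NNReal) (hv : v ≠ 0) (φ : Fin d → ℝ → ℝ)
    (hφ : ∀ l, Integrable (fun x => gaussianPDFReal 0 v x * φ l x)) :
    Integrable (fun w => gaussIsoE d 0 v w * ∏ l, φ l (w l)) ∧
    ∫ w, gaussIsoE d 0 v w * ∏ l, φ l (w l) = ∏ l, ∫ x, gaussianPDFReal 0 v x * φ l x := by
  have e : (fun w : EuclideanSpace ℝ (Fin d) => gaussIsoE d 0 v w * ∏ l, φ l (w l)) =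
      (fun u : Fin d → ℝ => ∏ l, (gaussianPDFReal 0 v (u l) * φ l (u l))) ∘ WithLp.ofLp := by
    ext w; simp [gaussIso_prod d v hv, Finset.prod_mul_distrib]
  have hm := PiLp.volume_preserving_ofLp (Fin d)
  constructor
  · rw [e]
    exact hm.integrable_comp_of_integrable (Integrable.fintype_prod hφ)
  · have := hm.integral_comp (MeasurableEquiv.toLp 2 (Fin d → ℝ)).symm.measurableEmbedding
      (fun u : Fin d → ℝ => ∏ l, (gaussianPDFReal 0 v (u l) * φ l (u l)))
    rw [e]
    refine this.trans ?_
    exact integral_fintype_prod_volume_eq_prod (fun l x => gaussianPDFReal 0 v x * φ l x)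

lemma gaussIso_moments (d : ℕ) (s : ℝ) (hs : 0 < s) :
    (Integrable (fun w => gaussIsoE d 0 s w * 1) ∧ ∫ w, gaussIsoE d 0 s w * 1 = 1) ∧
    (∀ i : Fin d, Integrable (fun w => gaussIsoE d 0 s w * w i)) ∧
    (∀ i j : Fin d, Integrable (fun w => gaussIsoE d 0 s w * (w i * w j)) ∧
      ∫ w, gaussIsoE d 0 s w * (w i * w j) = if i = j then s else 0) := by
  lift s to NNReal using hs.le
  have hv : s ≠ 0 := by rintro rfl; simp at hs
  obtain ⟨⟨a0, b0⟩, ⟨a1, b1⟩, a2, b2⟩ := gk_moments s hv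
  refine ⟨?_, ?_, ?_⟩
  · have := gaussIso_int d s hv (fun _ _ => 1) (fun _ => a0)
    simp only [b0, Finset.prod_const_one] at this
    exact this
  · intro i
    have := gaussIso_int d s hv (fun l x => if l = i then x else 1)
      (fun l => by by_cases h : l = i <;> simp only [h, if_true, if_false] <;> assumption)
    simpa using this.1
  · intro i j
    have hI : ∀ l, Integrable (fun x => ProbabilityTheory.gaussianPDFReal 0 s x *
        ((if l = i then x else 1) * (if l = j then x else 1))) := by
      intro l
      split_ifs
      · exact a2
      · simpa using a1
      · simpa using a1
      · simpa using a0
    have := gaussIso_int d s hv (fun l x => (if l = i then x else 1) * (if l = j then x else 1)) hI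
    simp only [Finset.prod_mul_distrib, Finset.prod_ite_eq', Finset.mem_univ, if_true] at this
    refine ⟨this.1, this.2.trans ?_⟩
    split_ifs with hij
    · subst hij
      rw [Finset.prod_eq_single i]
      · simpa using b2
      · intro l _ hl; simpa [hl] using b0
      · simp
    · apply Finset.prod_eq_zero (Finset.mem_univ i)
      simpa [hij] using b1

lemma total_var {E : Type*} [MeasurableSpace E] (μ : Measure E) [SFinite μ]
    (J f g : E → E → ℝ) (hJ : ∀ x y, 0 ≤ J x y) (hpos : ∀ y, 0 < ∫ x, J x y ∂μ)
    (h1 : ∀ y, Integrable (fun x => J x y) μ)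
    (hf : ∀ y, Integrable (fun x => J x y * f x y) μ)
    (hg : ∀ y, Integrable (fun x => J x y * g x y) μ)
    (hff : ∀ y, Integrable (fun x => J x y * (f x y * f x y)) μ)
    (hgg : ∀ y, Integrable (fun x => J x y * (g x y * g x y)) μ)
    (hfg : ∀ y, Integrable (fun x => J x y * (f x y * g x y)) μ)
    (p1 : Integrable (fun p : E × E => J p.1 p.2) (μ.prod μ))
    (pf : Integrable (fun p : E × E => J p.1 p.2 * f p.1 p.2) (μ.prod μ))
    (pg : Integrable (fun p : E × E => J p.1 p.2 * g p.1 p.2) (μ.prod μ))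
    (pff : Integrable (fun p : E × E => J p.1 p.2 * (f p.1 p.2 * f p.1 p.2)) (μ.prod μ))
    (pgg : Integrable (fun p : E × E => J p.1 p.2 * (g p.1 p.2 * g p.1 p.2)) (μ.prod μ))
    (pfg : Integrable (fun p : E × E => J p.1 p.2 * (f p.1 p.2 * g p.1 p.2)) (μ.prod μ))
    (F G : E → ℝ) (hF : ∀ y, F y = (∫ x, J x y ∂μ)⁻¹ * ∫ x, J x y * f x y ∂μ)
    (hG : ∀ y, G y = (∫ x, J x y ∂μ)⁻¹ * ∫ x, J x y * g x y ∂μ) :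
    ∫ p, J p.1 p.2 * (f p.1 p.2 * g p.1 p.2) ∂(μ.prod μ) =
      (∫ y, ∫ x, J x y * ((f x y - F y) * (g x y - G y)) ∂μ ∂μ)
        + ∫ y, (∫ x, J x y ∂μ) * (F y * G y) ∂μ := by
  have key : ∀ (f g : E → E → ℝ) (F G : E → ℝ) (y : E), Integrable (fun x => J x y * f x y) μ →
      Integrable (fun x => J x y * g x y) μ → Integrable (fun x => J x y * (f x y * g x y)) μ →
      (F y = (∫ x, J x y ∂μ)⁻¹ * ∫ x, J x y * f x y ∂μ) →
      (G y = (∫ x, J x y ∂μ)⁻¹ * ∫ x, J x y * g x y ∂μ) →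
      ∫ x, J x y * ((f x y - F y) * (g x y - G y)) ∂μ =
        (∫ x, J x y * (f x y * g x y) ∂μ) - (∫ x, J x y ∂μ) * (F y * G y) := by
    intro f g F G y hf hg hfg hF hG
    have e : ∀ x, J x y * ((f x y - F y) * (g x y - G y)) = J x y * (f x y * g x y)
        - G y * (J x y * f x y) - F y * (J x y * g x y) + (F y * G y) * J x y := by
      intro x; ring
    simp_rw [e]
    have c1 : Integrable (fun x => J x y * (f x y * g x y) - G y * (J x y * f x y)) μ :=
      hfg.sub (hf.const_mul _)
    have c2 : Integrable (fun x => J x y * (f x y * g x y) - G y * (J x y * f x y)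
        - F y * (J x y * g x y)) μ := c1.sub (hg.const_mul _)
    rw [integral_add c2 ((h1 y).const_mul _),
      integral_sub c1 (hg.const_mul _), integral_sub hfg (hf.const_mul _), integral_const_mul, integral_const_mul, integral_const_mul]
    have hm := (hpos y).ne'
    have a : ∫ x, J x y * f x y ∂μ = (∫ x, J x y ∂μ) * F y := by rw [hF]; field_simp
    have b : ∫ x, J x y * g x y ∂μ = (∫ x, J x y ∂μ) * G y := by rw [hG]; field_simp
    rw [a, b]; ring
  have nn : ∀ (f : E → E → ℝ) (F : E → ℝ) y,
      0 ≤ ∫ x, J x y * ((f x y - F y) * (f x y - F y)) ∂μ :=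
    fun f F y => integral_nonneg fun x => mul_nonneg (hJ x y) (mul_self_nonneg _)
  have m1 := p1.integral_prod_right
  have mf := pf.integral_prod_right
  have mg := pg.integral_prod_right
  have mff := pff.integral_prod_right
  have mgg := pgg.integral_prod_right
  have mfg := pfg.integral_prod_right
  have hI : Integrable (fun y => (∫ x, J x y ∂μ) * (F y * G y)) μ := by
    refine Integrable.mono' (mff.add mgg) ?_ (ae_of_all _ fun y => ?_)
    · have a1 := m1.aestronglyMeasurable.aemeasurable
      have a2 := mf.aestronglyMeasurable.aemeasurable
      have a3 := mg.aestronglyMeasurable.aemeasurable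
      simp_rw [hF, hG]
      exact (a1.mul ((a1.inv.mul a2).mul (a1.inv.mul a3))).aestronglyMeasurable
    · have x1 := nn f F y
      have x2 := nn g G y
      rw [key f f F F y (hf y) (hf y) (hff y) (hF y) (hF y)] at x1
      rw [key g g G G y (hg y) (hg y) (hgg y) (hG y) (hG y)] at x2
      have hm := hpos y
      simp only [Pi.add_apply]
      rw [Real.norm_eq_abs, abs_le]
      constructor <;>
        nlinarith [mul_nonneg hm.le (sq_nonneg (F y + G y)), mul_nonneg hm.le (sq_nonneg (F y - G y)),
          mul_nonneg hm.le (sq_nonneg (F y)), mul_nonneg hm.le (sq_nonneg (G y))]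
  rw [integral_prod_symm _ pfg]
  simp_rw [fun y => key f g F G y (hf y) (hg y) (hfg y) (hF y) (hG y)]
  rw [integral_sub mfg hI]; ring

lemma shear_int {d : ℕ} (a : ℝ) (A B : EuclideanSpace ℝ (Fin d) → ℝ)
    (hA : Integrable A) (hB : Integrable B) :
    Integrable (fun p : EuclideanSpace ℝ (Fin d) × EuclideanSpace ℝ (Fin d) =>
      A p.1 * B (p.2 - a • p.1)) (volume.prod volume) ∧
    ∫ p : EuclideanSpace ℝ (Fin d) × EuclideanSpace ℝ (Fin d),
      A p.1 * B (p.2 - a • p.1) ∂(volume.prod volume) = (∫ x, A x) * ∫ x, B x := by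
  have hm : MeasurePreserving (fun p : EuclideanSpace ℝ (Fin d) × EuclideanSpace ℝ (Fin d) =>
      (p.1, p.2 - a • p.1)) (volume.prod volume) (volume.prod volume) := by
    refine MeasurePreserving.skew_product (g := fun x y => y - a • x) (MeasurePreserving.id volume)
      (by unfold Function.uncurry; fun_prop) (ae_of_all _ fun x => ?_)
    exact (measurePreserving_sub_right volume (a • x)).map_eq
  have hAB := hA.mul_prod (ν := volume) hB
  refine ⟨hm.integrable_comp_of_integrable hAB, ?_⟩
  have h := integral_map hm.measurable.aemeasurable (f := fun z => A z.1 * B z.2)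
    (by rw [hm.map_eq]; exact hAB.aestronglyMeasurable)
  rw [hm.map_eq] at h
  rw [← integral_prod_mul, h]

lemma gauss_shift (d : ℕ) (μ : EuclideanSpace ℝ (Fin d)) (s : ℝ) (x : EuclideanSpace ℝ (Fin d)) :
    gaussIsoE d μ s x = gaussIsoE d 0 s (x - μ) := by simp [gaussIsoE]

lemma gauss_pos (d : ℕ) (μ : EuclideanSpace ℝ (Fin d)) (s : ℝ) (hs : 0 < s)
    (x : EuclideanSpace ℝ (Fin d)) : 0 < gaussIsoE d μ s x := by
  have : 0 < 2 * Real.pi * s := by positivity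
  unfold gaussIsoE; positivity

lemma gauss_le (d : ℕ) (μ : EuclideanSpace ℝ (Fin d)) (s : ℝ) (hs : 0 < s)
    (x : EuclideanSpace ℝ (Fin d)) : gaussIsoE d μ s x ≤ (2 * Real.pi * s) ^ (-(d : ℝ) / 2) := by
  have : 0 < 2 * Real.pi * s := by positivity
  unfold gaussIsoE
  refine mul_le_of_le_one_right (by positivity) (Real.exp_le_one_iff.2 ?_)
  rw [neg_div]
  have : 0 ≤ ‖x - μ‖ ^ 2 / (2 * s) := by positivity
  linarith

lemma gauss_norm_le (d : ℕ) (μ : EuclideanSpace ℝ (Fin d)) (s : ℝ) (hs : 0 < s)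
    (x : EuclideanSpace ℝ (Fin d)) :
    gaussIsoE d μ s x * ‖x - μ‖ ≤ (2 * Real.pi * s) ^ (-(d : ℝ) / 2) * (1 + 2 * s) := by
  have : 0 < 2 * Real.pi * s := by positivity
  unfold gaussIsoE
  rw [mul_assoc]
  refine mul_le_mul_of_nonneg_left ?_ (by positivity)
  set t := ‖x - μ‖ with ht
  have h := Real.add_one_le_exp (t ^ 2 / (2 * s))
  have ht2 : t ≤ 1 + t ^ 2 := by nlinarith [sq_nonneg (t - 1)]
  rw [neg_div, Real.exp_neg, inv_mul_le_iff₀ (Real.exp_pos _)]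
  have h3 : t ^ 2 = (t ^ 2 / (2 * s)) * (2 * s) := by field_simp
  have h4 : 0 ≤ t ^ 2 / (2 * s) := by positivity
  nlinarith

lemma gauss_hasFDeriv (d : ℕ) (μ : EuclideanSpace ℝ (Fin d)) (s : ℝ) (hs : 0 < s)
    (x : EuclideanSpace ℝ (Fin d)) :
    HasFDerivAt (fun y => gaussIsoE d μ s y)
      ((-(gaussIsoE d μ s x / s)) • innerSL ℝ (x - μ)) x := by
  have h1 : HasFDerivAt (fun y : EuclideanSpace ℝ (Fin d) => ‖y - μ‖ ^ 2)
      (2 • innerSL ℝ (x - μ)) x := by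
    simpa using ((hasFDerivAt_id x).sub_const μ).norm_sq
  have h2 := (((h1.neg).mul_const ((2 * s)⁻¹)).exp).const_mul ((2 * Real.pi * s) ^ (-(d : ℝ) / 2))
  unfold gaussIsoE
  simp only [div_eq_mul_inv _ (2 * s)]
  refine h2.congr_fderiv ?_
  ext v
  simp [smul_eq_mul]
  field_simp

lemma margN_hasFDeriv (d : ℕ) (ab : ℝ) (hab : ab ∈ Set.Ioo (0 : ℝ) 1)
    (q0 : EuclideanSpace ℝ (Fin d) → ℝ) (hq : Integrable q0) (hq0 : ∀ v, 0 ≤ q0 v)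
    (y : EuclideanSpace ℝ (Fin d)) :
    Integrable (fun x => (-(joint0n d q0 ab x y / (1 - ab))) • innerSL ℝ (y - Real.sqrt ab • x)) ∧
    HasFDerivAt (margN d q0 ab)
      (∫ x, (-(joint0n d q0 ab x y / (1 - ab))) • innerSL ℝ (y - Real.sqrt ab • x)) y := by
  have hs : 0 < 1 - ab := by linarith [hab.2]
  set a := Real.sqrt ab
  set C := (2 * Real.pi * (1 - ab)) ^ (-(d : ℝ) / 2) with hC
  have hgm : ∀ y : EuclideanSpace ℝ (Fin d),
      Continuous (fun x : EuclideanSpace ℝ (Fin d) => gaussIsoE d (a • x) (1 - ab) y) := by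
    intro y; unfold gaussIsoE; fun_prop
  have hJm : ∀ y, AEStronglyMeasurable (fun x => joint0n d q0 ab x y) := fun y =>
    hq.aestronglyMeasurable.mul (hgm y).aestronglyMeasurable
  have hFpm : ∀ y, AEStronglyMeasurable
      (fun x => (-(joint0n d q0 ab x y / (1 - ab))) • innerSL ℝ (y - a • x)) := by
    intro y
    refine AEStronglyMeasurable.smul ((hJm y).aemeasurable.div_const _).neg.aestronglyMeasurable ?_
    exact ((innerSL ℝ).continuous.comp (by fun_prop)).aestronglyMeasurable
  have hJi : ∀ y, Integrable (fun x => joint0n d q0 ab x y) := fun y =>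
    hq.mul_bdd (c := C) (hgm y).aestronglyMeasurable (ae_of_all _ fun x => by
      rw [Real.norm_eq_abs, abs_of_pos (gauss_pos d _ _ hs _)]; exact gauss_le d _ _ hs _)
  have hb : ∀ x y, ‖(-(joint0n d q0 ab x y / (1 - ab))) • innerSL ℝ (y - a • x)‖ ≤
      q0 x * (C * (1 + 2 * (1 - ab)) / (1 - ab)) := by
    intro x y
    rw [norm_smul, innerSL_apply_norm, norm_neg, norm_div, Real.norm_of_nonneg hs.le]
    unfold joint0n
    rw [Real.norm_of_nonneg (mul_nonneg (hq0 x) (gauss_pos d _ _ hs _).le)]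
    have := mul_le_mul_of_nonneg_left (gauss_norm_le d (a • x) _ hs y) (hq0 x)
    rw [mul_div_assoc', div_mul_eq_mul_div]
    refine div_le_div_of_nonneg_right ?_ hs.le
    rw [mul_assoc]; exact this
  refine ⟨(hq.mul_const _).mono' (hFpm y) (ae_of_all _ fun x => hb x y), ?_⟩
  refine hasFDerivAt_integral_of_dominated_of_fderiv_le (s := Set.univ)
    (F := fun y x => joint0n d q0 ab x y)
    (F' := fun y x => (-(joint0n d q0 ab x y / (1 - ab))) • innerSL ℝ (y - a • x))
    (bound := fun x => q0 x * (C * (1 + 2 * (1 - ab)) / (1 - ab)))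
    Filter.univ_mem (Filter.Eventually.of_forall hJm) (hJi y)
    (hFpm y) (ae_of_all _ fun x y _ => hb x y) (hq.mul_const _) (ae_of_all _ fun x y _ => ?_)
  refine ((gauss_hasFDeriv d (a • x) _ hs y).const_mul (q0 x)).congr_fderiv ?_
  rw [smul_smul]
  congr 1
  unfold joint0n; ring

lemma score_eq (d : ℕ) (ab : ℝ) (hab : ab ∈ Set.Ioo (0 : ℝ) 1)
    (q0 : EuclideanSpace ℝ (Fin d) → ℝ) (hq : Integrable q0) (hq0 : ∀ v, 0 ≤ q0 v)
    (y : EuclideanSpace ℝ (Fin d)) (hm : margN d q0 ab y ≠ 0) (i : Fin d) :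
    -(1 - ab) * scoreN d q0 ab y i = (margN d q0 ab y)⁻¹ *
      ∫ x, joint0n d q0 ab x y * ((y - Real.sqrt ab • x) i) := by
  have hs : 1 - ab ≠ 0 := by linarith [hab.2]
  obtain ⟨hi, hd⟩ := margN_hasFDeriv d ab hab q0 hq hq0 y
  have hl := (hd.log hm).fderiv
  have e1 : scoreN d q0 ab y i = fderiv ℝ (fun y => Real.log (margN d q0 ab y)) y
      (EuclideanSpace.single i 1) := by
    unfold scoreN gradient
    rw [← InnerProductSpace.toDual_symm_apply, EuclideanSpace.inner_single_right]
    simp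
  rw [e1, hl, smul_apply, ContinuousLinearMap.integral_apply hi, smul_eq_mul,
    mul_left_comm, ← integral_const_mul]
  congr 2
  ext x
  simp [EuclideanSpace.inner_single_right]
  field_simp
  ring

/-- for the forward marginal `q(xₙ|x₀) = N(√ᾱₙ x₀, β̄ₙ I)` with `ᾱₙ ∈ (0,1)`,
the expected conditional covariance of the data is determined by the score function,
`E_{q(xₙ)}[Cov_{q(x₀|xₙ)}[x₀]] = (β̄ₙ/ᾱₙ)(I − β̄ₙ E_{qₙ}[∇ log qₙ ∇ log qₙᵀ])` (entrywise),
and it contributes to the data covariance via the law of total variance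
`Cov_{q(x₀)}[x₀] = E_{q(xₙ)}[Cov_{q(x₀|xₙ)}[x₀]] + Cov_{q(xₙ)}[E_{q(x₀|xₙ)}[x₀]]`. -/
theorem stmt_16 {d : ℕ} (hd : 0 < d) (ab : ℝ) (hab : ab ∈ Set.Ioo (0 : ℝ) 1)
    (q0 : EuclideanSpace ℝ (Fin d) → ℝ)
    (hq0_nonneg : ∀ v, 0 ≤ q0 v) (hq0_meas : Measurable q0) (hq0_one : ∫ v, q0 v = 1)
    (hq0_mom2 : Integrable (fun v => q0 v * ‖v‖ ^ 2)) :
    (∀ i j : Fin d,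
      (∫ xn, ∫ x0, joint0n d q0 ab x0 xn *
          ((x0 i - condMean0 d q0 ab xn i) * (x0 j - condMean0 d q0 ab xn j)))
        = ((1 - ab) / ab) * ((if i = j then (1 : ℝ) else 0)
            - (1 - ab) * ∫ xn, margN d q0 ab xn *
                (scoreN d q0 ab xn i * scoreN d q0 ab xn j))) ∧
    (∀ i j : Fin d,
      (∫ x0, q0 x0 * ((x0 i - dataMean d q0 i) * (x0 j - dataMean d q0 j)))
        = (∫ xn, ∫ x0, joint0n d q0 ab x0 xn *
            ((x0 i - condMean0 d q0 ab xn i) * (x0 j - condMean0 d q0 ab xn j)))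
          + ∫ xn, margN d q0 ab xn *
              ((condMean0 d q0 ab xn i - dataMean d q0 i) *
                (condMean0 d q0 ab xn j - dataMean d q0 j))) := by
  have hs : 0 < 1 - ab := by linarith [hab.2]
  have hq : Integrable q0 := by
    by_contra h
    rw [integral_undef h] at hq0_one
    exact zero_ne_one hq0_one
  obtain ⟨⟨k0, k0'⟩, k1, k2⟩ := gaussIso_moments d (1 - ab) hs
  set a := Real.sqrt ab with ha
  have haa : a * a = ab := Real.mul_self_sqrt hab.1.le
  have hJ : ∀ x y, joint0n d q0 ab x y = q0 x * gaussIsoE d 0 (1 - ab) (y - a • x) := by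
    intro x y; unfold joint0n; rw [gauss_shift]
  have hgm : ∀ y : EuclideanSpace ℝ (Fin d),
      Continuous (fun x : EuclideanSpace ℝ (Fin d) => gaussIsoE d (a • x) (1 - ab) y) := by
    intro y; unfold gaussIsoE; fun_prop
  have hgb : ∀ x y : EuclideanSpace ℝ (Fin d), ‖gaussIsoE d (a • x) (1 - ab) y‖ ≤
      (2 * Real.pi * (1 - ab)) ^ (-(d : ℝ) / 2) := by
    intro x y
    rw [Real.norm_eq_abs, abs_of_pos (gauss_pos d _ _ hs _)]; exact gauss_le d _ _ hs _
  -- integrability against q0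
  have hci : ∀ (x : EuclideanSpace ℝ (Fin d)) i, |x i| ≤ ‖x‖ := fun x i => by
    simpa using PiLp.norm_apply_le x i
  have hqv : Integrable (fun x => q0 x • x) := by
    refine (hq.add hq0_mom2).mono' (hq.aestronglyMeasurable.smul
      continuous_id.aestronglyMeasurable) (ae_of_all _ fun x => ?_)
    rw [norm_smul, Real.norm_of_nonneg (hq0_nonneg x), Pi.add_apply]
    nlinarith [hq0_nonneg x, mul_nonneg (hq0_nonneg x) (sq_nonneg (‖x‖ - 1)),
      mul_nonneg (hq0_nonneg x) (sq_nonneg ‖x‖)]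
  have hq1 : ∀ i, Integrable (fun x => q0 x * x i) := fun i => by
    simpa using (EuclideanSpace.proj (𝕜 := ℝ) i).integrable_comp hqv
  have hq2 : ∀ i j, Integrable (fun x => q0 x * (x i * x j)) := fun i j => by
    refine hq0_mom2.mono' (hq.aestronglyMeasurable.mul
      (Continuous.aestronglyMeasurable (by fun_prop))) (ae_of_all _ fun x => ?_)
    rw [norm_mul, Real.norm_of_nonneg (hq0_nonneg x), Real.norm_eq_abs, abs_mul, sq]
    exact mul_le_mul_of_nonneg_left (mul_le_mul (hci x i) (hci x j) (abs_nonneg _) (norm_nonneg _))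
      (hq0_nonneg x)
  have hqc1 : ∀ i (c : ℝ), Integrable (fun x => q0 x * (x i - c)) := fun i c => by
    refine ((hq1 i).sub (hq.mul_const c)).congr (ae_of_all _ fun x => ?_)
    simp only [Pi.sub_apply]; ring
  have hqc2 : ∀ i j (c c' : ℝ), Integrable (fun x => q0 x * ((x i - c) * (x j - c'))) :=
    fun i j c c' => by
    refine (((hq2 i j).sub ((hq1 i).mul_const c')).sub ((hqc1 j c').const_mul c)).congr
      (ae_of_all _ fun x => ?_)
    simp only [Pi.sub_apply]; ring
  -- sections
  have hsec : ∀ u : EuclideanSpace ℝ (Fin d) → ℝ, Integrable (fun x => q0 x * u x) →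
      ∀ y, Integrable (fun x => joint0n d q0 ab x y * u x) := by
    intro u hu y
    refine (hu.mul_bdd (hgm y).aestronglyMeasurable (ae_of_all _ fun x => hgb x y)).congr
      (ae_of_all _ fun x => ?_)
    simp only [joint0n]; ring
  have s0 : ∀ y, Integrable (fun x => joint0n d q0 ab x y) := fun y => by
    simpa using hsec (fun _ => 1) (by simpa using hq) y
  have s1 := fun i => hsec _ (hq1 i)
  have s2 := fun i j => hsec _ (hq2 i j)
  have hwi : ∀ (x y : EuclideanSpace ℝ (Fin d)) i, (y - a • x) i = y i - a * x i := by
    intro x y i; simp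
  have sw1 : ∀ i y, Integrable (fun x => joint0n d q0 ab x y * ((y - a • x) i)) := fun i y => by
    refine (((s0 y).mul_const (y i)).sub ((s1 i y).const_mul a)).congr (ae_of_all _ fun x => ?_)
    simp only [Pi.sub_apply, hwi]; ring
  have sw2 : ∀ i j y, Integrable (fun x => joint0n d q0 ab x y *
      ((y - a • x) i * (y - a • x) j)) := fun i j y => by
    refine (((sw1 i y).mul_const (y j)).sub ((((s1 j y).const_mul (a * y i))).sub
      ((s2 i j y).const_mul (a * a)))).congr (ae_of_all _ fun x => ?_)
    simp only [Pi.sub_apply, hwi]; ring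
  -- positivity
  have hJ0 : ∀ x y, 0 ≤ joint0n d q0 ab x y := fun x y =>
    mul_nonneg (hq0_nonneg x) (gauss_pos d _ _ hs _).le
  have hpos : ∀ y, 0 < ∫ x, joint0n d q0 ab x y := by
    intro y
    refine lt_of_le_of_ne (integral_nonneg fun x => hJ0 x y) fun h => ?_
    have h' := (integral_eq_zero_iff_of_nonneg (fun x => hJ0 x y) (s0 y)).1 h.symm
    have : q0 =ᵐ[volume] 0 := by
      filter_upwards [h'] with x hx
      exact (mul_eq_zero.1 hx).resolve_right (gauss_pos d _ _ hs _).ne'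
    rw [integral_congr_ae this] at hq0_one
    simp at hq0_one
  -- product integrability
  have hprod : ∀ u v : EuclideanSpace ℝ (Fin d) → ℝ, Integrable (fun x => q0 x * u x) →
      Integrable (fun w => gaussIsoE d 0 (1 - ab) w * v w) →
      Integrable (fun p : EuclideanSpace ℝ (Fin d) × EuclideanSpace ℝ (Fin d) =>
        joint0n d q0 ab p.1 p.2 * (u p.1 * v (p.2 - a • p.1))) (volume.prod volume) ∧
      ∫ p : EuclideanSpace ℝ (Fin d) × EuclideanSpace ℝ (Fin d),
        joint0n d q0 ab p.1 p.2 * (u p.1 * v (p.2 - a • p.1)) ∂(volume.prod volume) =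
        (∫ x, q0 x * u x) * ∫ w, gaussIsoE d 0 (1 - ab) w * v w := by
    intro u v hu hv
    have h := shear_int a _ _ hu hv
    have e : (fun p : EuclideanSpace ℝ (Fin d) × EuclideanSpace ℝ (Fin d) =>
        joint0n d q0 ab p.1 p.2 * (u p.1 * v (p.2 - a • p.1))) = fun p =>
        q0 p.1 * u p.1 * (gaussIsoE d 0 (1 - ab) (p.2 - a • p.1) * v (p.2 - a • p.1)) := by
      ext p; rw [hJ]; ring
    rw [e]; exact h
  have hq' : Integrable (fun x => q0 x * (fun _ => (1:ℝ)) x) := by simpa using hq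
  have pJ := (hprod (fun _ => 1) (fun _ => 1) hq' k0).1
  simp only [mul_one] at pJ
  have pu : ∀ u : EuclideanSpace ℝ (Fin d) → ℝ, Integrable (fun x => q0 x * u x) → _ :=
    fun u hu => hprod u (fun _ => 1) hu k0
  simp only [mul_one] at pu k0'
  have pv : ∀ v : EuclideanSpace ℝ (Fin d) → ℝ,
      Integrable (fun w => gaussIsoE d 0 (1 - ab) w * v w) → _ :=
    fun v hv => hprod (fun _ => 1) v hq' hv
  simp only [mul_one, one_mul, hq0_one] at pv
  -- conditional mean
  have hcm : ∀ y i, condMean0 d q0 ab y i = (∫ x, joint0n d q0 ab x y)⁻¹ *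
      ∫ x, joint0n d q0 ab x y * x i := by
    intro y i
    have hv : Integrable (fun x => joint0n d q0 ab x y • x) := by
      refine (hqv.bdd_smul _ (hgm y).aestronglyMeasurable (ae_of_all _ fun x => hgb x y)).congr
        (ae_of_all _ fun x => ?_)
      simp only [joint0n, Pi.smul_apply', smul_smul]; congr 1; ring
    have h := (EuclideanSpace.proj (𝕜 := ℝ) i).integral_comp_comm hv
    simp only [condMean0, margN, PiLp.smul_apply, smul_eq_mul]
    congr 1
    exact h.symm
  have hcmw : ∀ y i, y i - a * condMean0 d q0 ab y i = (∫ x, joint0n d q0 ab x y)⁻¹ *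
      ∫ x, joint0n d q0 ab x y * ((y - a • x) i) := by
    intro y i
    have e : ∀ x, joint0n d q0 ab x y * ((y - a • x) i) =
      joint0n d q0 ab x y * y i - a * (joint0n d q0 ab x y * x i) := by
      intro x; rw [hwi]; ring
    simp_rw [e]
    rw [integral_sub ((s0 y).mul_const _) ((s1 i y).const_mul _), integral_mul_const,
      integral_const_mul, hcm]
    have := (hpos y).ne'
    field_simp
  have hcmc : ∀ y i c, condMean0 d q0 ab y i - c = (∫ x, joint0n d q0 ab x y)⁻¹ *
      ∫ x, joint0n d q0 ab x y * (x i - c) := by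
    intro y i c
    simp_rw [mul_sub]
    rw [integral_sub (s1 i y) ((s0 y).mul_const _), integral_mul_const, hcm]
    have := (hpos y).ne'
    field_simp
  constructor
  · intro i j
    have T := total_var volume (joint0n d q0 ab) (fun x y => (y - a • x) i)
      (fun x y => (y - a • x) j) hJ0 hpos s0 (sw1 i) (sw1 j) (sw2 i i) (sw2 j j) (sw2 i j) pJ
      (pv _ (k1 i)).1 (pv _ (k1 j)).1 (pv _ (k2 i i).1).1 (pv _ (k2 j j).1).1 (pv _ (k2 i j).1).1
      (fun y => y i - a * condMean0 d q0 ab y i) (fun y => y j - a * condMean0 d q0 ab y j)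
      (fun y => hcmw y i) (fun y => hcmw y j)
    rw [(pv _ (k2 i j).1).2, (k2 i j).2] at T
    have e1 : ∀ x y : EuclideanSpace ℝ (Fin d), joint0n d q0 ab x y *
        (((y - a • x) i - (y i - a * condMean0 d q0 ab y i)) *
          ((y - a • x) j - (y j - a * condMean0 d q0 ab y j))) = ab * (joint0n d q0 ab x y *
        ((x i - condMean0 d q0 ab y i) * (x j - condMean0 d q0 ab y j))) := by
      intro x y; rw [hwi, hwi, ← haa]; ring
    have hsc : ∀ y i, y i - a * condMean0 d q0 ab y i = -(1 - ab) * scoreN d q0 ab y i := by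
      intro y i
      rw [score_eq d ab hab q0 hq hq0_nonneg y (hpos y).ne' i, hcmw]; rfl
    have e2 : ∀ y : EuclideanSpace ℝ (Fin d), (∫ x, joint0n d q0 ab x y) *
        ((y i - a * condMean0 d q0 ab y i) * (y j - a * condMean0 d q0 ab y j)) =
        (1 - ab) ^ 2 * (margN d q0 ab y * (scoreN d q0 ab y i * scoreN d q0 ab y j)) := by
      intro y; rw [hsc, hsc]; unfold margN; ring
    simp only [e1, e2, integral_const_mul] at T
    have hab0 : ab ≠ 0 := hab.1.ne'
    rw [div_mul_eq_mul_div, eq_div_iff hab0]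
    have e3 : (if i = j then 1 - ab else 0) = (1 - ab) * (if i = j then (1:ℝ) else 0) := by
      split_ifs <;> simp
    rw [e3] at T
    linarith
  · intro i j
    have T := total_var volume (joint0n d q0 ab) (fun x y => x i - dataMean d q0 i)
      (fun x y => x j - dataMean d q0 j) hJ0 hpos s0 (hsec _ (hqc1 i _)) (hsec _ (hqc1 j _))
      (hsec _ (hqc2 i i _ _)) (hsec _ (hqc2 j j _ _)) (hsec _ (hqc2 i j _ _)) pJ
      (pu _ (hqc1 i _)).1 (pu _ (hqc1 j _)).1
      (pu _ (hqc2 i i _ _)).1 (pu _ (hqc2 j j _ _)).1 (pu _ (hqc2 i j _ _)).1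
      (fun y => condMean0 d q0 ab y i - dataMean d q0 i)
      (fun y => condMean0 d q0 ab y j - dataMean d q0 j)
      (fun y => hcmc y i _) (fun y => hcmc y j _)
    rw [(pu _ (hqc2 i j _ _)).2, k0', mul_one] at T
    simp only [sub_sub_sub_cancel_right] at T
    exact T
end
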